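/- arXiv:2102.04602 — 10 statements merged into one kernel-verified Lean document; each statement's English description precedes it below -/
import Mathlib

section
/- If two ellipsoids η and ξ in ℝⁿ satisfy η ⊆ ξ, then ξ ⊆ 2(|ξ|/|η|)·η, where |·| denotes Lebesgue measure and the dilate is taken about the center of η. Moreover, if η and ξ have the same center, then ξ ⊆ (|ξ|/|η|)·η. -/
open MeasureTheory Set Pointwise Matrix

noncomputable section

/-- The ellipsoid `M(𝔹ⁿ) + c` : image of the closed Euclidean unit ball under the
linear map given by the matrix `M`, translated by the center `c`. -/
def ell {n : ℕ} (M : Matrix (Fin n) (Fin n) ℝ) (c : EuclideanSpace ℝ (Fin n)) :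
    Set (EuclideanSpace ℝ (Fin n)) :=
  (fun z => Matrix.toEuclideanLin M z + c) '' Metric.closedBall 0 1

/-- Lebesgue measure of a set, as a real number. -/
def volR {n : ℕ} (E : Set (EuclideanSpace ℝ (Fin n))) : ℝ := (volume E).toReal

/-- The (Euclidean) operator norm of a matrix. -/
def opNorm {n : ℕ} (A : Matrix (Fin n) (Fin n) ℝ) : ℝ :=
  ‖LinearMap.toContinuousLinearMap (Matrix.toEuclideanLin A)‖

theorem contr_det {n : ℕ} (L : EuclideanSpace ℝ (Fin n) →ₗ[ℝ] EuclideanSpace ℝ (Fin n))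
    (hL : ∀ u, ‖u‖ ≤ 1 → ‖L u‖ ≤ 1) (v : EuclideanSpace ℝ (Fin n)) :
    |LinearMap.det L| * ‖v‖ ≤ ‖L v‖ := by
  by_cases hv : v = 0
  · simp [hv]
  have hv' : 0 < ‖v‖ := norm_pos_iff.2 hv
  rcases n with _ | n
  · exact absurd (Subsingleton.elim v 0) hv
  have hon : Orthonormal ℝ (({0} : Set (Fin (n+1))).domRestrict
      (fun _ => (‖v‖⁻¹ : ℝ) • v)) := by
    constructor
    · intro i
      simp [norm_smul, hv'.ne']
    · intro i j hij
      exact absurd (Subsingleton.elim i j) hij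
  obtain ⟨b, hb⟩ := hon.exists_orthonormalBasis_extension_of_card_eq (by simp)
  have hb0 : b 0 = (‖v‖⁻¹ : ℝ) • v := hb 0 rfl
  haveI : Fact (Module.finrank ℝ (EuclideanSpace ℝ (Fin (n+1))) = n+1) := ⟨by simp⟩
  have h1 := b.toBasis.orientation.abs_volumeForm_apply_le (L ∘ b)
  rw [b.toBasis.orientation.volumeForm_robust' b, Module.Basis.det_comp] at h1
  have h2 : b.toBasis.det b = 1 := by
    have := b.toBasis.det_self
    rwa [b.coe_toBasis] at this
  rw [h2, mul_one, Fin.prod_univ_succ] at h1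
  have h3 : ∏ i : Fin n, ‖(L ∘ b) i.succ‖ ≤ 1 :=
    Finset.prod_le_one (fun i _ => norm_nonneg _) (fun i _ => hL _ (by simp))
  have h4 : |LinearMap.det L| ≤ ‖L (b 0)‖ :=
    h1.trans (mul_le_of_le_one_right (norm_nonneg _) h3)
  rw [hb0, map_smul, norm_smul, norm_inv, norm_norm, inv_mul_eq_div, le_div_iff₀ hv'] at h4
  exact h4

theorem volR_ell {n : ℕ} (M : Matrix (Fin n) (Fin n) ℝ) (c : EuclideanSpace ℝ (Fin n)) :
    volR (ell M c) = |M.det| * volR (Metric.closedBall (0 : EuclideanSpace ℝ (Fin n)) 1) := by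
  have h : ell M c = (fun x => x + c) '' (Matrix.toEuclideanLin M '' Metric.closedBall 0 1) := by
    rw [Set.image_image]; rfl
  unfold volR
  rw [h, Set.image_add_right, measure_preimage_add_right, Measure.addHaar_image_linearMap,
    LinearMap.det_toLpLin, ENNReal.toReal_mul, ENNReal.toReal_ofReal (abs_nonneg _)]

theorem volR_ball_pos {n : ℕ} :
    0 < volR (Metric.closedBall (0 : EuclideanSpace ℝ (Fin n)) 1) :=
  ENNReal.toReal_pos (Metric.measure_closedBall_pos _ _ one_pos).ne'
    measure_closedBall_lt_top.ne

theorem toE_mul {n : ℕ} (A B C : Matrix (Fin n) (Fin n) ℝ) (h : A * B = C)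
    (x : EuclideanSpace ℝ (Fin n)) :
    Matrix.toEuclideanLin A (Matrix.toEuclideanLin B x) = Matrix.toEuclideanLin C x := by
  rw [← h, Matrix.toLpLin_mul_same]; rfl

theorem toE_one {n : ℕ} (x : EuclideanSpace ℝ (Fin n)) :
    Matrix.toEuclideanLin (1 : Matrix (Fin n) (Fin n) ℝ) x = x := by
  rw [Matrix.toLpLin_one]; rfl

theorem core {n : ℕ} (Mη Mξ : Matrix (Fin n) (Fin n) ℝ)
    (cη cξ : EuclideanSpace ℝ (Fin n))
    (hMη : IsUnit Mη) (hMξ : IsUnit Mξ)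
    (hsub : ell Mη cη ⊆ ell Mξ cξ) (k : ℝ) (hk : 0 < k)
    (hz : ∀ z d : EuclideanSpace ℝ (Fin n), ‖z‖ ≤ 1 → ‖d‖ ≤ 1 →
      d = Matrix.toEuclideanLin Mξ⁻¹ (cη - cξ) → ‖z - d‖ ≤ k) :
    ell Mξ cξ ⊆ ell ((k * (volR (ell Mξ cξ) / volR (ell Mη cη))) • Mη) cη := by
  have uη := (Matrix.isUnit_iff_isUnit_det _).1 hMη
  have uξ := (Matrix.isUnit_iff_isUnit_det _).1 hMξ
  have pη : 0 < |Mη.det| := abs_pos.2 uη.ne_zero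
  have pξ : 0 < |Mξ.det| := abs_pos.2 uξ.ne_zero
  rw [volR_ell, volR_ell, mul_div_mul_right _ _ volR_ball_pos.ne']
  set d := Matrix.toEuclideanLin Mξ⁻¹ (cη - cξ) with hd
  have hdet : |LinearMap.det (Matrix.toEuclideanLin (Mξ⁻¹ * Mη))| = |Mη.det| / |Mξ.det| := by
    rw [LinearMap.det_toLpLin, Matrix.det_mul, Matrix.det_nonsing_inv, abs_mul,
      Ring.inverse_eq_inv', abs_inv, inv_mul_eq_div]
  set L := Matrix.toEuclideanLin (Mξ⁻¹ * Mη) with hLdef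
  have hLd : ∀ u, ‖u‖ ≤ 1 → ‖L u + d‖ ≤ 1 := by
    intro u hu
    obtain ⟨z, hz1, hz2⟩ := hsub ⟨u, by simpa using hu, rfl⟩
    have hz2 : Matrix.toEuclideanLin Mξ z + cξ = Matrix.toEuclideanLin Mη u + cη := hz2
    have e : Matrix.toEuclideanLin Mξ z = Matrix.toEuclideanLin Mη u + (cη - cξ) := by
      rw [← add_sub_assoc, ← hz2, add_sub_cancel_right]
    have e2 := congrArg (Matrix.toEuclideanLin Mξ⁻¹) e
    rw [toE_mul _ _ _ (Matrix.nonsing_inv_mul _ uξ), toE_one, map_add,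
      toE_mul _ _ _ rfl] at e2
    rw [hLdef, hd, ← e2]
    simpa using hz1
  have hd1 : ‖d‖ ≤ 1 := by simpa using hLd 0 (by simp)
  have hL : ∀ u, ‖u‖ ≤ 1 → ‖L u‖ ≤ 1 := by
    intro u hu
    have h1 := hLd u hu
    have h2 := hLd (-u) (by simpa using hu)
    have h3 : (2 : ℝ) • L u = (L u + d) - (L (-u) + d) := by
      rw [map_neg, two_smul]; abel
    have h4 : ‖(2 : ℝ) • L u‖ ≤ 1 + 1 := by
      rw [h3]; exact (norm_sub_le _ _).trans (add_le_add h1 h2)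
    rw [norm_smul] at h4
    norm_num at h4
    linarith
  rintro _ ⟨z, hz1, rfl⟩
  have hz1 : ‖z‖ ≤ 1 := by simpa using hz1
  set y := Matrix.toEuclideanLin Mη⁻¹ (Matrix.toEuclideanLin Mξ z - (cη - cξ)) with hy
  have hMy : Matrix.toEuclideanLin Mη y = Matrix.toEuclideanLin Mξ z - (cη - cξ) := by
    rw [hy, toE_mul _ _ _ (Matrix.mul_nonsing_inv _ uη), toE_one]
  have hLy : L y = z - d := by
    rw [hLdef, ← toE_mul _ _ _ rfl, hMy, map_sub, toE_mul _ _ _ (Matrix.nonsing_inv_mul _ uξ),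
      toE_one]
  have h5 := contr_det L hL y
  rw [hLy, hdet] at h5
  have h6 := h5.trans (hz z d hz1 hd1 rfl)
  have hr : 0 < k * (|Mξ.det| / |Mη.det|) := by positivity
  refine ⟨(k * (|Mξ.det| / |Mη.det|))⁻¹ • y, ?_, ?_⟩
  · rw [mem_closedBall_zero_iff, norm_smul, norm_inv, Real.norm_of_nonneg hr.le,
      inv_mul_le_iff₀ hr, mul_one]
    rw [div_mul_eq_mul_div, div_le_iff₀ pξ] at h6
    rw [← mul_div_assoc, le_div_iff₀ pη]
    linarith
  · show Matrix.toEuclideanLin ((k * (|Mξ.det| / |Mη.det|)) • Mη) _ + cη = _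
    rw [map_smul, map_smul, LinearMap.smul_apply, smul_smul, inv_mul_cancel₀ hr.ne', one_smul, hMy]
    abel

/-- If two ellipsoids `η ⊆ ξ` in `ℝⁿ`, then `ξ ⊆ 2(|ξ|/|η|)·η` (dilation about the
center of `η`); moreover if they have the same center, `ξ ⊆ (|ξ|/|η|)·η`. -/
theorem stmt0 {n : ℕ} (Mη Mξ : Matrix (Fin n) (Fin n) ℝ)
    (cη cξ : EuclideanSpace ℝ (Fin n))
    (hMη : IsUnit Mη) (hMξ : IsUnit Mξ)
    (hsub : ell Mη cη ⊆ ell Mξ cξ) :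
    ell Mξ cξ ⊆ ell ((2 * (volR (ell Mξ cξ) / volR (ell Mη cη))) • Mη) cη ∧
    (cη = cξ → ell Mξ cξ ⊆ ell ((volR (ell Mξ cξ) / volR (ell Mη cη)) • Mη) cη) := by
  constructor
  · refine core Mη Mξ cη cξ hMη hMξ hsub 2 two_pos ?_
    intro z d hz hd _
    linarith [norm_sub_le z d]
  · intro hc
    have := core Mη Mξ cη cξ hMη hMξ hsub 1 one_pos (by
      intro z d hz _ hd
      rw [hd, hc]
      simpa using hz)
    rwa [one_mul] at this
end
end

section
/- Let D = diag(λ₁, λ₂, …, λₙ) be a diagonal n×n real matrix and let c ∈ ℝⁿ. If 𝔹ⁿ ⊆ D(𝔹ⁿ) + c, then 𝔹ⁿ ⊆ D(𝔹ⁿ). -/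
open MeasureTheory Set Pointwise Matrix

noncomputable section

/-- If `𝔹ⁿ ⊆ D(𝔹ⁿ) + c` for a diagonal matrix `D`, then `𝔹ⁿ ⊆ D(𝔹ⁿ)`. -/
theorem stmt1 {n : ℕ} (lam : Fin n → ℝ) (c : EuclideanSpace ℝ (Fin n))
    (h : Metric.closedBall (0 : EuclideanSpace ℝ (Fin n)) 1
      ⊆ ell (Matrix.diagonal lam) c) :
    Metric.closedBall (0 : EuclideanSpace ℝ (Fin n)) 1
      ⊆ ell (Matrix.diagonal lam) 0 := by
  intro x hx
  have hx' : -x ∈ Metric.closedBall (0 : EuclideanSpace ℝ (Fin n)) 1 := by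
    simpa using hx
  obtain ⟨z, hz, hzx⟩ := h hx
  obtain ⟨w, hw, hwx⟩ := h hx'
  simp only [mem_closedBall_zero_iff] at hz hw
  refine ⟨(1 / 2 : ℝ) • (z - w), ?_, ?_⟩
  · rw [mem_closedBall_zero_iff, norm_smul]
    have := norm_sub_le z w
    norm_num
    linarith
  · simp only at hzx hwx ⊢
    have e : Matrix.toEuclideanLin (Matrix.diagonal lam) z
        - Matrix.toEuclideanLin (Matrix.diagonal lam) w = (2 : ℝ) • x := by
      rw [eq_sub_of_add_eq hzx, eq_sub_of_add_eq hwx, two_smul]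
      abel
    rw [map_smul, map_sub, e, smul_smul]
    norm_num
end
end

section
/- Let A be a nonsingular n×n real matrix, let λ₁, …, λₙ be the eigenvalues of AAᵀ, and let D = diag(√λ₁, …, √λₙ). If 𝔹ⁿ ⊆ A(𝔹ⁿ) + c for some c ∈ ℝⁿ, then there exists an orthogonal matrix U such that 𝔹ⁿ ⊆ UA(𝔹ⁿ) = D(𝔹ⁿ). In particular, λᵢ ≥ 1 for all i = 1, …, n. -/
open MeasureTheory Set Pointwise Matrix

noncomputable section

theorem aux_mul {n : ℕ} (M N : Matrix (Fin n) (Fin n) ℝ) (z : EuclideanSpace ℝ (Fin n)) :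
    Matrix.toEuclideanLin (M * N) z = Matrix.toEuclideanLin M (Matrix.toEuclideanLin N z) := by
  simp [Matrix.toLpLin_apply, Matrix.mulVec_mulVec]

theorem aux_one {n : ℕ} (z : EuclideanSpace ℝ (Fin n)) :
    Matrix.toEuclideanLin (1 : Matrix (Fin n) (Fin n) ℝ) z = z := by
  simp [Matrix.toLpLin_apply]

theorem aux_norm {n : ℕ} (W : Matrix (Fin n) (Fin n) ℝ) (hW : Wᵀ * W = 1)
    (z : EuclideanSpace ℝ (Fin n)) : ‖Matrix.toEuclideanLin W z‖ = ‖z‖ := by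
  have h : inner ℝ (Matrix.toEuclideanLin W z) (Matrix.toEuclideanLin W z) = inner ℝ z z := by
    rw [← LinearMap.adjoint_inner_right, ← Matrix.toEuclideanLin_conjTranspose_eq_adjoint,
      Matrix.conjTranspose_eq_transpose_of_trivial, ← aux_mul, hW, aux_one]
  rw [real_inner_self_eq_norm_sq, real_inner_self_eq_norm_sq] at h
  exact (pow_left_inj₀ (norm_nonneg _) (norm_nonneg _) two_ne_zero).1 h

theorem aux_center {n : ℕ} (A : Matrix (Fin n) (Fin n) ℝ) (c : EuclideanSpace ℝ (Fin n))
    (h : Metric.closedBall (0 : EuclideanSpace ℝ (Fin n)) 1 ⊆ ell A c) :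
    Metric.closedBall (0 : EuclideanSpace ℝ (Fin n)) 1 ⊆ ell A 0 := by
  intro x hx
  obtain ⟨z₁, h₁, e₁⟩ := h hx
  obtain ⟨z₂, h₂, e₂⟩ := h (show -x ∈ Metric.closedBall 0 1 by simpa using hx)
  simp only [mem_closedBall_zero_iff] at h₁ h₂ e₁ e₂
  refine ⟨(1 / 2 : ℝ) • (z₁ - z₂), ?_, ?_⟩
  · rw [mem_closedBall_zero_iff, norm_smul]
    have := norm_sub_le z₁ z₂
    norm_num
    linarith
  · simp only [map_smul, map_sub, add_zero]
    rw [eq_sub_of_add_eq e₁, eq_sub_of_add_eq e₂]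
    module

theorem aux_ell {n : ℕ} (M W : Matrix (Fin n) (Fin n) ℝ) (hW : W * Wᵀ = 1) :
    ell (M * W) 0 = ell M 0 := by
  have hW' : Wᵀ * W = 1 := mul_eq_one_comm.1 hW
  ext x
  constructor
  · rintro ⟨z, hz, rfl⟩
    refine ⟨Matrix.toEuclideanLin W z, ?_, by simp only [aux_mul]⟩
    rw [mem_closedBall_zero_iff] at *
    rwa [aux_norm W hW']
  · rintro ⟨z, hz, rfl⟩
    refine ⟨Matrix.toEuclideanLin Wᵀ z, ?_, ?_⟩
    · rw [mem_closedBall_zero_iff] at *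
      rwa [aux_norm Wᵀ (by simpa using hW)]
    · simp only
      rw [← aux_mul, Matrix.mul_assoc, hW, Matrix.mul_one]

/-- If `A` is nonsingular and `𝔹ⁿ ⊆ A(𝔹ⁿ) + c`, then there is an orthogonal matrix `U`
with `𝔹ⁿ ⊆ UA(𝔹ⁿ) = D(𝔹ⁿ)`, where `D = diag(√λ₁,…,√λₙ)` with `λᵢ` the eigenvalues
of `AAᵀ`; in particular all `λᵢ ≥ 1`. -/
theorem stmt2 {n : ℕ} (A : Matrix (Fin n) (Fin n) ℝ) (hA : IsUnit A)
    (c : EuclideanSpace ℝ (Fin n)) (hH : (A * Aᵀ).IsHermitian)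
    (h : Metric.closedBall (0 : EuclideanSpace ℝ (Fin n)) 1 ⊆ ell A c) :
    (∃ U : Matrix (Fin n) (Fin n) ℝ, U * Uᵀ = 1 ∧
      Metric.closedBall (0 : EuclideanSpace ℝ (Fin n)) 1 ⊆ ell (U * A) 0 ∧
      ell (U * A) 0
        = ell (Matrix.diagonal fun i => Real.sqrt (hH.eigenvalues i)) 0) ∧
    ∀ i, 1 ≤ hH.eigenvalues i := by
  have hpd : (A * Aᵀ).PosDef := by
    have := Matrix.PosDef.mul_conjTranspose_self A (Matrix.vecMul_injective_of_isUnit hA)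
    simpa using this
  have hpos : ∀ i, 0 < hH.eigenvalues i := fun i => hpd.eigenvalues_pos i
  set V : Matrix (Fin n) (Fin n) ℝ := (hH.eigenvectorUnitary : Matrix (Fin n) (Fin n) ℝ) with hV
  have hVV : Vᵀ * V = 1 := by
    have := (Unitary.mem_iff.1 hH.eigenvectorUnitary.2).1
    simpa [Matrix.star_eq_conjTranspose] using this
  have hspec : Vᵀ * (A * Aᵀ) * V = Matrix.diagonal hH.eigenvalues := by
    have h1 : A * Aᵀ = V * Matrix.diagonal hH.eigenvalues * Vᵀ := by
      have := hH.spectral_theorem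
      simpa [Unitary.conjStarAlgAut_apply, Matrix.star_eq_conjTranspose, Function.comp_def]
        using this
    calc Vᵀ * (A * Aᵀ) * V = Vᵀ * (V * Matrix.diagonal hH.eigenvalues * Vᵀ) * V :=
          congrArg (fun X => Vᵀ * X * V) h1
      _ = (Vᵀ * V) * Matrix.diagonal hH.eigenvalues * (Vᵀ * V) := by
          simp only [Matrix.mul_assoc]
      _ = _ := by rw [hVV]; simp
  set s : Fin n → ℝ := fun i => Real.sqrt (hH.eigenvalues i) with hs
  have hs0 : ∀ i, 0 < s i := fun i => Real.sqrt_pos.2 (hpos i)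
  have hss : ∀ i, s i * s i = hH.eigenvalues i := fun i => Real.mul_self_sqrt (hpos i).le
  set W : Matrix (Fin n) (Fin n) ℝ := Matrix.diagonal (fun i => (s i)⁻¹) * (Vᵀ * A) with hWdef
  have hDW : Vᵀ * A = Matrix.diagonal s * W := by
    rw [hWdef, ← Matrix.mul_assoc, Matrix.diagonal_mul_diagonal]
    have : (fun i => s i * (s i)⁻¹) = fun _ => 1 := by
      funext i; exact mul_inv_cancel₀ (hs0 i).ne'
    rw [this, Matrix.diagonal_one, Matrix.one_mul]
  have hWW : W * Wᵀ = 1 := by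
    calc W * Wᵀ = Matrix.diagonal (fun i => (s i)⁻¹) * (Vᵀ * (A * Aᵀ) * V)
          * Matrix.diagonal (fun i => (s i)⁻¹) := by
          rw [hWdef]
          simp only [Matrix.transpose_mul, Matrix.transpose_transpose,
            Matrix.diagonal_transpose, Matrix.mul_assoc]
      _ = 1 := by
          rw [hspec, Matrix.diagonal_mul_diagonal, Matrix.diagonal_mul_diagonal,
            ← Matrix.diagonal_one]
          congr 1
          funext i
          rw [← hss i]
          have := (hs0 i).ne'
          field_simp
  have heq : ell (Vᵀ * A) 0 = ell (Matrix.diagonal s) 0 := by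
    rw [hDW]; exact aux_ell _ _ hWW
  have hsub : Metric.closedBall (0 : EuclideanSpace ℝ (Fin n)) 1 ⊆ ell (Vᵀ * A) 0 := by
    intro x hx
    have hx' : Matrix.toEuclideanLin V x ∈ Metric.closedBall 0 1 := by
      rw [mem_closedBall_zero_iff] at *
      rwa [aux_norm V hVV]
    obtain ⟨z, hz, e⟩ := aux_center A c h hx'
    refine ⟨z, hz, ?_⟩
    simp only [add_zero] at e ⊢
    rw [aux_mul, e, ← aux_mul, hVV, aux_one]
  refine ⟨⟨Vᵀ, by simpa using hVV, hsub, heq⟩, fun i => ?_⟩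
  have hb : EuclideanSpace.single i (1 : ℝ) ∈ ell (Matrix.diagonal s) 0 :=
    heq ▸ hsub (by simp)
  obtain ⟨z, hz, e⟩ := hb
  have e' := congrArg (fun v : EuclideanSpace ℝ (Fin n) => v i) e
  simp [Matrix.toLpLin_apply, Matrix.mulVec_diagonal] at e'
  rw [mem_closedBall_zero_iff] at hz
  have hzi : z i ≤ 1 := (le_abs_self _).trans ((PiLp.norm_apply_le z i).trans hz)
  have h1 : 1 ≤ s i := by nlinarith [hs0 i]
  rw [← hss i]
  nlinarith
end
end

section
/- If two ellipsoids in ℝⁿ satisfy η ⊆ ξ, then η − c_η ⊆ ξ − c_ξ, where c_η and c_ξ are the centers of η and ξ, respectively. -/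
open MeasureTheory Set Pointwise Matrix

noncomputable section

/-- If two ellipsoids satisfy `η ⊆ ξ`, then `η − c_η ⊆ ξ − c_ξ` where `c_η, c_ξ`
are their centers. -/
theorem stmt3 {n : ℕ} (Mη Mξ : Matrix (Fin n) (Fin n) ℝ)
    (cη cξ : EuclideanSpace ℝ (Fin n))
    (hMη : IsUnit Mη) (hMξ : IsUnit Mξ)
    (hsub : ell Mη cη ⊆ ell Mξ cξ) :
    (fun z => z - cη) '' ell Mη cη ⊆ (fun z => z - cξ) '' ell Mξ cξ := by
  rintro _ ⟨_, ⟨w, hw, rfl⟩, rfl⟩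
  have hw' : -w ∈ Metric.closedBall (0 : EuclideanSpace ℝ (Fin n)) 1 := by
    simpa using hw
  obtain ⟨u, hu, hu2⟩ := hsub ⟨w, hw, rfl⟩
  obtain ⟨v, hv, hv2⟩ := hsub ⟨-w, hw', rfl⟩
  simp only [map_neg] at hu2 hv2
  rw [mem_closedBall_zero_iff] at hu hv
  refine ⟨_, ⟨(1 / 2 : ℝ) • (u - v), ?_, rfl⟩, ?_⟩
  · rw [mem_closedBall_zero_iff, norm_smul]
    have := norm_sub_le u v
    norm_num
    linarith
  · simp only [add_sub_cancel_right, map_smul, map_sub]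
    have h1 := eq_sub_of_add_eq hu2
    have h2 := eq_sub_of_add_eq hv2
    rw [h1, h2]
    module
end
end

section
/- Let Θ = {θ_{x,t} : x ∈ ℝⁿ, t ∈ ℝ} be a collection of ellipsoids θ_{x,t} = M_{x,t}(𝔹ⁿ) + x (with M_{x,t} nonsingular) satisfying the volume condition a₁2^{−t} ≤ |θ_{x,t}| ≤ a₂2^{−t} for some constants a₁, a₂ > 0. Then the shape condition holds with constants a₃, a₄, a₅, a₆ > 0 (i.e., for all x, y ∈ ℝⁿ, t ∈ ℝ, s ≥ 0 with θ_{x,t} ∩ θ_{y,t+s} ≠ ∅ one has a₃2^{−a₄s} ≤ 1/‖(M_{y,t+s})⁻¹M_{x,t}‖ ≤ ‖(M_{x,t})⁻¹M_{y,t+s}‖ ≤ a₅2^{−a₆s}) if and only if there exist constants a₃′, a₅′ > 0 such that for any two ellipsoids ξ, η ∈ Θ with |η| ≤ |ξ| and ξ ∩ η ≠ ∅ one has a₃′(|η|/|ξ|)^{a₄}(ξ − c_ξ) ⊆ η − c_η ⊆ a₅′(|η|/|ξ|)^{a₆}(ξ − c_ξ), where c_ξ and c_η are the centers of ξ and η.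 (The exponents a₄ and a₆ are the same in both formulations; the constants a₃, a₅ and a₃′, a₅′ may differ.) -/
open MeasureTheory Set Pointwise Matrix

noncomputable section

lemma transfer {I : Type*} (R : I → I → Prop) (hR : ∀ i j, R i j → R j i) (N : I → I → ℝ)
    (hN : ∀ i j, 0 ≤ N i j) (v w : I → ℝ) (hv : ∀ i, 0 < v i) (hw : ∀ i, 0 < w i)
    (K : ℝ) (hK : 0 < K) (hvw : ∀ i j, v j / v i ≤ K * (w j / w i)) (a b : ℝ)
    (ha : 0 < a) (hb : 0 < b)
    (h : ∃ c d : ℝ, 0 < c ∧ 0 < d ∧ ∀ i j, w j ≤ w i → R i j →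
      N j i * (c * (w j / w i) ^ a) ≤ 1 ∧ N i j ≤ d * (w j / w i) ^ b) :
    ∃ c d : ℝ, 0 < c ∧ 0 < d ∧ ∀ i j, v j ≤ v i → R i j →
      N j i * (c * (v j / v i) ^ a) ≤ 1 ∧ N i j ≤ d * (v j / v i) ^ b := by
  obtain ⟨c, d, hc, hd, h⟩ := h
  have hKa : 0 < K ^ a := Real.rpow_pos_of_pos hK _
  have hKb : 0 < K ^ b := Real.rpow_pos_of_pos hK _
  refine ⟨min (c / K ^ a) (1 / d), max (d * K ^ b) (K ^ a / c * K ^ b), by positivity,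
    lt_max_of_lt_left (by positivity), ?_⟩
  intro i j hij hRij
  have hr : 0 < v j / v i := div_pos (hv j) (hv i)
  have hr1 : v j / v i ≤ 1 := (div_le_one (hv i)).2 hij
  have hwi := hw i
  have hwj := hw j
  have hvi := hv i
  have hvj := hv j
  have h1 := hvw i j
  have h2 : w j / w i ≤ K * (v j / v i) := by
    have := hvw j i
    rw [div_le_iff₀ hvj] at this
    rw [div_le_iff₀ hwi]
    field_simp at this ⊢
    linarith
  have hra : 0 < (v j / v i) ^ a := Real.rpow_pos_of_pos hr _
  have hrb : 0 < (v j / v i) ^ b := Real.rpow_pos_of_pos hr _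
  rcases le_total (w j) (w i) with hc1 | hc1
  · obtain ⟨h3, h4⟩ := h i j hc1 hRij
    have hρ : 0 < w j / w i := div_pos hwj hwi
    constructor
    · refine le_trans (mul_le_mul_of_nonneg_left ?_ (hN j i)) h3
      calc _ ≤ c / K ^ a * (v j / v i) ^ a := by gcongr; exact min_le_left _ _
        _ ≤ c / K ^ a * (K * (w j / w i)) ^ a := by gcongr
        _ = _ := by rw [Real.mul_rpow hK.le hρ.le]; field_simp
    · refine h4.trans ?_
      calc _ ≤ d * (K * (v j / v i)) ^ b := by gcongr
        _ = d * K ^ b * (v j / v i) ^ b := by rw [Real.mul_rpow hK.le hr.le]; ring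
        _ ≤ _ := by gcongr; exact le_max_left _ _
  · obtain ⟨h3, h4⟩ := h j i hc1 (hR _ _ hRij)
    have hρ : 0 < w i / w j := div_pos hwi hwj
    have hρ1 : w i / w j ≤ 1 := (div_le_one hwj).2 hc1
    have h5 : 1 ≤ K * (w i / w j) := le_trans ((one_le_div hvj).2 hij) (hvw j i)
    have h6 : 1 ≤ K * (v j / v i) := le_trans ((one_le_div hwi).2 hc1) h2
    have hρa : 0 < (w i / w j) ^ a := Real.rpow_pos_of_pos hρ _
    constructor
    · have h7 : N j i ≤ d := h4.trans (mul_le_of_le_one_right hd.le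
        (Real.rpow_le_one hρ.le hρ1 hb.le))
      calc N j i * (min (c / K ^ a) (1 / d) * (v j / v i) ^ a) ≤ d * (1 / d * 1) := by
            gcongr
            · exact min_le_right _ _
            · exact Real.rpow_le_one hr.le hr1 ha.le
        _ = 1 := by field_simp
    · have h8 : 1 ≤ K ^ a * (w i / w j) ^ a := by
        rw [← Real.mul_rpow hK.le hρ.le]; exact Real.one_le_rpow h5 ha.le
      have h9 : 1 ≤ K ^ b * (v j / v i) ^ b := by
        rw [← Real.mul_rpow hK.le hr.le]; exact Real.one_le_rpow h6 hb.le
      have h10 : N i j ≤ K ^ a / c := by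
        rw [le_div_iff₀ hc]
        calc N i j * c ≤ N i j * c * (K ^ a * (w i / w j) ^ a) :=
              le_mul_of_one_le_right (mul_nonneg (hN _ _) hc.le) h8
          _ = K ^ a * (N i j * (c * (w i / w j) ^ a)) := by ring
          _ ≤ K ^ a * 1 := by gcongr
          _ = K ^ a := mul_one _
      calc N i j ≤ K ^ a / c * (K ^ b * (v j / v i) ^ b) :=
            h10.trans (le_mul_of_one_le_right (by positivity) h9)
        _ = K ^ a / c * K ^ b * (v j / v i) ^ b := by ring
        _ ≤ _ := by gcongr; exact le_max_right _ _

lemma ell_sub {n : ℕ} (A : Matrix (Fin n) (Fin n) ℝ) (c : EuclideanSpace ℝ (Fin n)) :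
    (fun z => z - c) '' ell A c = Matrix.toEuclideanLin A '' Metric.closedBall 0 1 := by
  unfold ell
  rw [image_image]
  simp

lemma lin_mul {n : ℕ} (A B : Matrix (Fin n) (Fin n) ℝ) (z : EuclideanSpace ℝ (Fin n)) :
    Matrix.toEuclideanLin (A * B) z = Matrix.toEuclideanLin A (Matrix.toEuclideanLin B z) := by
  simp [Matrix.toLpLin_apply, Matrix.mulVec_mulVec]

lemma opNorm_nonneg {n : ℕ} (A : Matrix (Fin n) (Fin n) ℝ) : 0 ≤ opNorm A := norm_nonneg _

lemma le_opNorm' {n : ℕ} (A : Matrix (Fin n) (Fin n) ℝ) (z : EuclideanSpace ℝ (Fin n)) :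
    ‖Matrix.toEuclideanLin A z‖ ≤ opNorm A * ‖z‖ :=
  (LinearMap.toContinuousLinearMap (Matrix.toEuclideanLin A)).le_opNorm z

lemma opNorm_le_iff {n : ℕ} (A : Matrix (Fin n) (Fin n) ℝ) (μ : ℝ) (hμ : 0 ≤ μ) :
    opNorm A ≤ μ ↔ ∀ z ∈ Metric.closedBall (0 : EuclideanSpace ℝ (Fin n)) 1,
      ‖Matrix.toEuclideanLin A z‖ ≤ μ := by
  constructor
  · intro h z hz
    have hz' : ‖z‖ ≤ 1 := by simpa using hz
    exact (le_opNorm' A z).trans ((mul_le_of_le_one_right (opNorm_nonneg A) hz').trans h)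
  · intro h
    refine ContinuousLinearMap.opNorm_le_of_unit_norm (𝕜 := ℝ) hμ ?_
    intro z hz
    exact h z (by simp [hz])

lemma lin_inv {n : ℕ} (A : Matrix (Fin n) (Fin n) ℝ) (hA : IsUnit A)
    (z : EuclideanSpace ℝ (Fin n)) :
    Matrix.toEuclideanLin A⁻¹ (Matrix.toEuclideanLin A z) = z ∧
    Matrix.toEuclideanLin A (Matrix.toEuclideanLin A⁻¹ z) = z := by
  have hd : IsUnit A.det := (Matrix.isUnit_iff_isUnit_det A).1 hA
  rw [← lin_mul, ← lin_mul, Matrix.nonsing_inv_mul _ hd, Matrix.mul_nonsing_inv _ hd]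
  simp [Matrix.toLpLin_apply]

lemma sub_upper {n : ℕ} (A C : Matrix (Fin n) (Fin n) ℝ) (hA : IsUnit A) (μ : ℝ) (hμ : 0 < μ) :
    (Matrix.toEuclideanLin C '' Metric.closedBall 0 1 ⊆
      μ • (Matrix.toEuclideanLin A '' Metric.closedBall 0 1)) ↔ opNorm (A⁻¹ * C) ≤ μ := by
  rw [opNorm_le_iff _ _ hμ.le, image_subset_iff]
  refine forall₂_congr fun z hz => ?_
  rw [mem_preimage, mem_smul_set_iff_inv_smul_mem₀ hμ.ne', lin_mul]
  constructor
  · rintro ⟨w, hw, hwe⟩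
    have : Matrix.toEuclideanLin A⁻¹ (Matrix.toEuclideanLin C z) = μ • w := by
      rw [← (lin_inv A hA (μ • w)).1, map_smul (Matrix.toEuclideanLin A), hwe,
        smul_inv_smul₀ hμ.ne']
    rw [this, norm_smul, Real.norm_of_nonneg hμ.le]
    exact mul_le_of_le_one_right hμ.le (by simpa using hw)
  · intro h
    refine ⟨μ⁻¹ • Matrix.toEuclideanLin A⁻¹ (Matrix.toEuclideanLin C z), ?_, ?_⟩
    · rw [mem_closedBall_zero_iff, norm_smul, Real.norm_of_nonneg (inv_nonneg.2 hμ.le)]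
      rw [inv_mul_le_iff₀ hμ]; simpa using h
    · rw [map_smul, (lin_inv A hA _).2]

lemma sub_lower {n : ℕ} (A C : Matrix (Fin n) (Fin n) ℝ) (hC : IsUnit C) (μ : ℝ) (hμ : 0 < μ) :
    (μ • (Matrix.toEuclideanLin A '' Metric.closedBall 0 1) ⊆
      Matrix.toEuclideanLin C '' Metric.closedBall 0 1) ↔ opNorm (C⁻¹ * A) * μ ≤ 1 := by
  rw [← le_div_iff₀ hμ, one_div, ← sub_upper C A hC μ⁻¹ (inv_pos.2 hμ),
    Set.smul_set_subset_iff₀ hμ.ne']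

lemma one_le_opNorm_mul {n : ℕ} (hn : n ≠ 0) (A C : Matrix (Fin n) (Fin n) ℝ) (hA : IsUnit A)
    (hC : IsUnit C) : 1 ≤ opNorm (A⁻¹ * C) * opNorm (C⁻¹ * A) := by
  let z : EuclideanSpace ℝ (Fin n) := EuclideanSpace.single ⟨0, Nat.pos_of_ne_zero hn⟩ 1
  have hz : ‖z‖ = 1 := by simp [z]
  have h1 : Matrix.toEuclideanLin (A⁻¹ * C) (Matrix.toEuclideanLin (C⁻¹ * A) z) = z := by
    rw [lin_mul, lin_mul, (lin_inv C hC _).2, (lin_inv A hA _).1]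
  have h2 := le_opNorm' (A⁻¹ * C) (Matrix.toEuclideanLin (C⁻¹ * A) z)
  have h3 := le_opNorm' (C⁻¹ * A) z
  rw [h1, hz] at h2
  rw [hz, mul_one] at h3
  exact h2.trans (mul_le_mul_of_nonneg_left h3 (opNorm_nonneg _))

/-- For a family `θ_{x,t} = M_{x,t}(𝔹ⁿ)+x` of ellipsoids satisfying the volume
condition `a₁2^{-t} ≤ |θ_{x,t}| ≤ a₂2^{-t}`, the shape condition (with exponents
`a₄, a₆` and some constants `a₃, a₅ > 0`) holds if and only if there are constants
`a₃', a₅' > 0` such that for any two intersecting ellipsoids `ξ = θ_{x,t}`,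
`η = θ_{y,u}` of the family with `|η| ≤ |ξ|`,
`a₃'(|η|/|ξ|)^{a₄}(ξ−c_ξ) ⊆ η−c_η ⊆ a₅'(|η|/|ξ|)^{a₆}(ξ−c_ξ)`. -/
theorem stmt4 {n : ℕ} (M : EuclideanSpace ℝ (Fin n) → ℝ → Matrix (Fin n) (Fin n) ℝ)
    (hM : ∀ x t, IsUnit (M x t))
    (a₁ a₂ : ℝ) (ha₁ : 0 < a₁) (ha₂ : 0 < a₂)
    (hvol : ∀ x t, a₁ * 2 ^ (-t) ≤ volR (ell (M x t) x) ∧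
      volR (ell (M x t) x) ≤ a₂ * 2 ^ (-t))
    (a₄ a₆ : ℝ) (ha₄ : 0 < a₄) (ha₆ : 0 < a₆) :
    (∃ a₃ a₅ : ℝ, 0 < a₃ ∧ 0 < a₅ ∧
      ∀ x y t s, 0 ≤ s → (ell (M x t) x ∩ ell (M y (t + s)) y).Nonempty →
        a₃ * 2 ^ (-(a₄ * s)) ≤ 1 / opNorm ((M y (t + s))⁻¹ * M x t) ∧
        1 / opNorm ((M y (t + s))⁻¹ * M x t) ≤ opNorm ((M x t)⁻¹ * M y (t + s)) ∧
        opNorm ((M x t)⁻¹ * M y (t + s)) ≤ a₅ * 2 ^ (-(a₆ * s)))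
    ↔ (∃ a₃' a₅' : ℝ, 0 < a₃' ∧ 0 < a₅' ∧
      ∀ x y t u, volR (ell (M y u) y) ≤ volR (ell (M x t) x) →
        (ell (M x t) x ∩ ell (M y u) y).Nonempty →
        (a₃' * (volR (ell (M y u) y) / volR (ell (M x t) x)) ^ a₄) •
            ((fun z => z - x) '' ell (M x t) x)
          ⊆ (fun z => z - y) '' ell (M y u) y ∧
        (fun z => z - y) '' ell (M y u) y
          ⊆ (a₅' * (volR (ell (M y u) y) / volR (ell (M x t) x)) ^ a₆) •
            ((fun z => z - x) '' ell (M x t) x)) := by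
  have hn : n ≠ 0 := by
    rintro rfl
    have hlim := (tendsto_rpow_atTop_of_base_gt_one (2 : ℝ) (by norm_num)).eventually_gt_atTop
      (volR (ell (M 0 0) 0) / a₁)
    obtain ⟨t, ht⟩ := hlim.exists
    have h1 := (hvol 0 (-t)).1
    rw [Subsingleton.elim (M 0 (-t)) (M 0 0), neg_neg] at h1
    rw [div_lt_iff₀ ha₁] at ht
    linarith
  let E := EuclideanSpace ℝ (Fin n)
  let v : E × ℝ → ℝ := fun p => volR (ell (M p.1 p.2) p.1)
  let w : E × ℝ → ℝ := fun p => (2 : ℝ) ^ (-p.2)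
  let N : E × ℝ → E × ℝ → ℝ := fun p q => opNorm ((M p.1 p.2)⁻¹ * M q.1 q.2)
  let R : E × ℝ → E × ℝ → Prop := fun p q => (ell (M p.1 p.2) p.1 ∩ ell (M q.1 q.2) q.1).Nonempty
  have hR : ∀ i j, R i j → R j i := fun i j h => by
    simp only [R] at h ⊢; rwa [inter_comm]
  have hN : ∀ i j, 0 ≤ N i j := fun i j => opNorm_nonneg _
  have hw : ∀ i, 0 < w i := fun i => Real.rpow_pos_of_pos (by norm_num) _
  have hv1 : ∀ i, a₁ * w i ≤ v i := fun i => (hvol i.1 i.2).1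
  have hv2 : ∀ i, v i ≤ a₂ * w i := fun i => (hvol i.1 i.2).2
  have hv : ∀ i, 0 < v i := fun i => lt_of_lt_of_le (mul_pos ha₁ (hw i)) (hv1 i)
  have hvw : ∀ i j, v j / v i ≤ a₂ / a₁ * (w j / w i) := fun i j => by
    have := hw i; have := hw j
    calc v j / v i ≤ (a₂ * w j) / (a₁ * w i) := 
          div_le_div₀ (by positivity) (hv2 j) (by positivity) (hv1 i)
      _ = _ := by field_simp
  have hwv : ∀ i j, w j / w i ≤ a₂ / a₁ * (v j / v i) := fun i j => by
    have h1 := hw i; have h2 := hw j; have h3 := hv i; have h4 := hv j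
    have h5 := hvw j i
    rw [div_le_iff₀ h4] at h5
    rw [div_le_iff₀ h1]
    field_simp at h5 ⊢
    linarith
  have hleft : (∃ a₃ a₅ : ℝ, 0 < a₃ ∧ 0 < a₅ ∧
      ∀ x y t s, 0 ≤ s → (ell (M x t) x ∩ ell (M y (t + s)) y).Nonempty →
        a₃ * 2 ^ (-(a₄ * s)) ≤ 1 / opNorm ((M y (t + s))⁻¹ * M x t) ∧
        1 / opNorm ((M y (t + s))⁻¹ * M x t) ≤ opNorm ((M x t)⁻¹ * M y (t + s)) ∧
        opNorm ((M x t)⁻¹ * M y (t + s)) ≤ a₅ * 2 ^ (-(a₆ * s))) ↔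
      ∃ c d : ℝ, 0 < c ∧ 0 < d ∧ ∀ i j, w j ≤ w i → R i j →
      N j i * (c * (w j / w i) ^ a₄) ≤ 1 ∧ N i j ≤ d * (w j / w i) ^ a₆ := by
    have hpow : ∀ (a t s : ℝ), ((2:ℝ) ^ (-(t + s)) / 2 ^ (-t)) ^ a = 2 ^ (-(a * s)) := by
      intro a t s
      rw [← Real.rpow_sub (by norm_num), ← Real.rpow_mul (by norm_num)]
      congr 1; ring
    have hpos : ∀ i j, 0 < N i j := fun i j => by
      have := one_le_opNorm_mul hn _ _ (hM i.1 i.2) (hM j.1 j.2)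
      by_contra h
      have h0 : N i j = 0 := le_antisymm (not_lt.1 h) (hN i j)
      simp only [N] at h0
      rw [h0] at this
      norm_num at this
    refine exists₂_congr fun c d => and_congr_right fun hc => and_congr_right fun hd => ?_
    constructor
    · rintro h ⟨x, t⟩ ⟨y, u⟩ hle hr
      have htu : t ≤ u := by
        have := (Real.rpow_le_rpow_left_iff (x := 2) (by norm_num)).1 hle
        simpa using this
      obtain ⟨s, rfl⟩ : ∃ s, u = t + s := ⟨u - t, by ring⟩
      obtain ⟨h1, -, h3⟩ := h x y t s (by linarith) hr
      have hp := hpos (y, t + s) (x, t)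
      simp only [w, hpow]
      refine ⟨?_, h3⟩
      rw [le_div_iff₀ hp] at h1
      rw [mul_comm]; exact h1
    · intro h x y t s hs hr
      obtain ⟨h1, h3⟩ := h (x, t) (y, t + s)
        ((Real.rpow_le_rpow_left_iff (x := 2) (by norm_num)).2 (by simpa using hs)) hr
      have hp := hpos (y, t + s) (x, t)
      simp only [w, hpow] at h1 h3
      refine ⟨?_, ?_, h3⟩
      · rw [le_div_iff₀ hp, mul_comm]; exact h1
      · rw [div_le_iff₀ hp]
        exact one_le_opNorm_mul hn _ _ (hM _ _) (hM _ _)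
  have hright : (∃ a₃' a₅' : ℝ, 0 < a₃' ∧ 0 < a₅' ∧
      ∀ x y t u, volR (ell (M y u) y) ≤ volR (ell (M x t) x) →
        (ell (M x t) x ∩ ell (M y u) y).Nonempty →
        (a₃' * (volR (ell (M y u) y) / volR (ell (M x t) x)) ^ a₄) •
            ((fun z => z - x) '' ell (M x t) x)
          ⊆ (fun z => z - y) '' ell (M y u) y ∧
        (fun z => z - y) '' ell (M y u) y
          ⊆ (a₅' * (volR (ell (M y u) y) / volR (ell (M x t) x)) ^ a₆) •
            ((fun z => z - x) '' ell (M x t) x)) ↔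
      ∃ c d : ℝ, 0 < c ∧ 0 < d ∧ ∀ i j, v j ≤ v i → R i j →
      N j i * (c * (v j / v i) ^ a₄) ≤ 1 ∧ N i j ≤ d * (v j / v i) ^ a₆ := by
    refine exists₂_congr fun c d => and_congr_right fun hc => and_congr_right fun hd => ?_
    have key : ∀ x y t u, ((c * (volR (ell (M y u) y) / volR (ell (M x t) x)) ^ a₄) •
            ((fun z => z - x) '' ell (M x t) x)
          ⊆ (fun z => z - y) '' ell (M y u) y ∧
        (fun z => z - y) '' ell (M y u) y
          ⊆ (d * (volR (ell (M y u) y) / volR (ell (M x t) x)) ^ a₆) •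
            ((fun z => z - x) '' ell (M x t) x)) ↔
        (N (y, u) (x, t) * (c * (v (y, u) / v (x, t)) ^ a₄) ≤ 1 ∧
          N (x, t) (y, u) ≤ d * (v (y, u) / v (x, t)) ^ a₆) := by
      intro x y t u
      have hr : 0 < volR (ell (M y u) y) / volR (ell (M x t) x) := div_pos (hv (y, u)) (hv (x, t))
      rw [ell_sub, ell_sub, sub_lower _ _ (hM y u) _ (mul_pos hc (Real.rpow_pos_of_pos hr _)),
        sub_upper _ _ (hM x t) _ (mul_pos hd (Real.rpow_pos_of_pos hr _))]
    constructor
    · rintro h ⟨x, t⟩ ⟨y, u⟩ hle hr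
      exact (key x y t u).1 (h x y t u hle hr)
    · intro h x y t u hle hr
      exact (key x y t u).2 (h (x, t) (y, u) hle hr)
  rw [hleft, hright]
  exact ⟨transfer R hR N hN v w hv hw _ (div_pos ha₂ ha₁) hvw a₄ a₆ ha₄ ha₆,
    transfer R hR N hN w v hw hv _ (div_pos ha₂ ha₁) hwv a₄ a₆ ha₄ ha₆⟩
end
end

section
/- Let Θ be a continuous ellipsoid cover of ℝⁿ. For x, y ∈ ℝⁿ define ρ₁(x,y) := inf{|θ_{x,t}| : t ∈ ℝ, y ∈ θ_{x,t}} (infimum over ellipsoids of Θ centered at x containing y) and ρ₂(x,y) := inf{|θ_{y,t}| : t ∈ ℝ, x ∈ θ_{y,t}}, and set ρ̃_Θ(x,y) := min{ρ₁(x,y), ρ₂(x,y)}. Then ρ̃_Θ is a quasi-distance on ℝⁿ which is equivalent to ρ_Θ(x,y) := inf{|θ| : θ ∈ Θ, x, y ∈ θ}; that is, there exists a constant C ≥ 1 with C⁻¹ρ_Θ(x,y) ≤ ρ̃_Θ(x,y) ≤ Cρ_Θ(x,y) for all x, y ∈ ℝⁿ. -/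
open MeasureTheory Set Pointwise Matrix

noncomputable section

/-- A continuous ellipsoid cover of `ℝⁿ`, with ellipsoids
`θ_{x,t} = ell (M x t) x` and parameters `a₁,…,a₆`. -/
structure Cover (n : ℕ) where
  M : EuclideanSpace ℝ (Fin n) → ℝ → Matrix (Fin n) (Fin n) ℝ
  a₁ : ℝ
  a₂ : ℝ
  a₃ : ℝ
  a₄ : ℝ
  a₅ : ℝ
  a₆ : ℝ
  a₁_pos : 0 < a₁
  a₂_pos : 0 < a₂
  a₃_pos : 0 < a₃
  a₄_pos : 0 < a₄
  a₅_pos : 0 < a₅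
  a₆_pos : 0 < a₆
  inv : ∀ x t, IsUnit (M x t)
  vol_lb : ∀ x t, a₁ * 2 ^ (-t) ≤ volR (ell (M x t) x)
  vol_ub : ∀ x t, volR (ell (M x t) x) ≤ a₂ * 2 ^ (-t)
  shape_lb : ∀ x y t s, 0 ≤ s → (ell (M x t) x ∩ ell (M y (t + s)) y).Nonempty →
    a₃ * 2 ^ (-(a₄ * s)) ≤ 1 / opNorm ((M y (t + s))⁻¹ * M x t)
  shape_mid : ∀ x y t s, 0 ≤ s → (ell (M x t) x ∩ ell (M y (t + s)) y).Nonempty →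
    1 / opNorm ((M y (t + s))⁻¹ * M x t) ≤ opNorm ((M x t)⁻¹ * M y (t + s))
  shape_ub : ∀ x y t s, 0 ≤ s → (ell (M x t) x ∩ ell (M y (t + s)) y).Nonempty →
    opNorm ((M x t)⁻¹ * M y (t + s)) ≤ a₅ * 2 ^ (-(a₆ * s))

/-- The quasi-distance induced by a continuous ellipsoid cover:
`ρ_Θ(x,y) = inf {|θ| : θ ∈ Θ, x,y ∈ θ}`. -/
def rhoCover {n : ℕ} (Θ : Cover n) (x y : EuclideanSpace ℝ (Fin n)) : ℝ :=
  sInf {v : ℝ | ∃ z t, x ∈ ell (Θ.M z t) z ∧ y ∈ ell (Θ.M z t) z ∧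
    v = volR (ell (Θ.M z t) z)}

/-- The ball of radius `r` about `x` for the quasi-distance `ρ_Θ`. -/
def ballCover {n : ℕ} (Θ : Cover n) (x : EuclideanSpace ℝ (Fin n)) (r : ℝ) :
    Set (EuclideanSpace ℝ (Fin n)) :=
  {y | rhoCover Θ x y < r}

/-- `ρ₁(x,y)`: infimum of volumes of ellipsoids of `Θ` centered at `x` containing `y`. -/
def rho1 {n : ℕ} (Θ : Cover n) (x y : EuclideanSpace ℝ (Fin n)) : ℝ :=
  sInf {v : ℝ | ∃ t, y ∈ ell (Θ.M x t) x ∧ v = volR (ell (Θ.M x t) x)}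

/-- `ρ̃_Θ(x,y) = min{ρ₁(x,y), ρ₂(x,y)}` where `ρ₂(x,y) = ρ₁(y,x)`. -/
def rhoTilde {n : ℕ} (Θ : Cover n) (x y : EuclideanSpace ℝ (Fin n)) : ℝ :=
  min (rho1 Θ x y) (rho1 Θ y x)

theorem ell_mem_iff {n : ℕ} (M : Matrix (Fin n) (Fin n) ℝ) (hM : IsUnit M)
    (c y : EuclideanSpace ℝ (Fin n)) :
    y ∈ ell M c ↔ ‖Matrix.toEuclideanLin M⁻¹ (y - c)‖ ≤ 1 := by
  have hd : IsUnit M.det := (Matrix.isUnit_iff_isUnit_det M).1 hM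
  constructor
  · rintro ⟨z, hz, rfl⟩
    have : Matrix.toEuclideanLin M⁻¹ (Matrix.toEuclideanLin M z + c - c) = z := by
      rw [add_sub_cancel_right]
      simp [Matrix.toLpLin_apply, Matrix.mulVec_mulVec, Matrix.nonsing_inv_mul M hd]
    have h2 : ‖z‖ ≤ 1 := by simpa using hz
    exact (congrArg norm this).trans_le h2
  · intro h
    refine ⟨Matrix.toEuclideanLin M⁻¹ (y - c), by simpa using h, ?_⟩
    have : Matrix.toEuclideanLin M (Matrix.toEuclideanLin M⁻¹ (y - c)) = y - c := by
      simp [Matrix.toLpLin_apply, Matrix.mulVec_mulVec, Matrix.mul_nonsing_inv M hd]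
    simp only [this, sub_add_cancel]

theorem ell_self {n : ℕ} (Θ : Cover n) (x : EuclideanSpace ℝ (Fin n)) (t : ℝ) :
    x ∈ ell (Θ.M x t) x := by
  rw [ell_mem_iff _ (Θ.inv x t)]; simp

theorem shape_vec {n : ℕ} (Θ : Cover n) (x y : EuclideanSpace ℝ (Fin n)) (t t' : ℝ) (h : t ≤ t')
    (hne : (ell (Θ.M x t) x ∩ ell (Θ.M y t') y).Nonempty) (u : EuclideanSpace ℝ (Fin n)) :
    ‖Matrix.toEuclideanLin (Θ.M x t)⁻¹ u‖ ≤
      Θ.a₅ * 2 ^ (-(Θ.a₆ * (t' - t))) * ‖Matrix.toEuclideanLin (Θ.M y t')⁻¹ u‖ := by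
  have hd : IsUnit (Θ.M y t').det := (Matrix.isUnit_iff_isUnit_det _).1 (Θ.inv y t')
  have h1 := Θ.shape_ub x y t (t' - t) (by linarith) (by simpa using hne)
  rw [add_sub_cancel] at h1
  have h2 := (LinearMap.toContinuousLinearMap (Matrix.toEuclideanLin
    ((Θ.M x t)⁻¹ * Θ.M y t'))).le_opNorm (Matrix.toEuclideanLin (Θ.M y t')⁻¹ u)
  have h3 : (LinearMap.toContinuousLinearMap (Matrix.toEuclideanLin
    ((Θ.M x t)⁻¹ * Θ.M y t'))) (Matrix.toEuclideanLin (Θ.M y t')⁻¹ u)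
      = Matrix.toEuclideanLin (Θ.M x t)⁻¹ u := by
    simp [Matrix.toLpLin_apply, Matrix.mulVec_mulVec, Matrix.mul_assoc,
      Matrix.mul_nonsing_inv _ hd]
  rw [h3] at h2
  exact h2.trans (mul_le_mul_of_nonneg_right h1 (norm_nonneg _))

theorem exists_decay {a b e : ℝ} (ha : 0 < a) (hb : 0 < b) (he : 0 < e) :
    ∃ c : ℝ, 0 ≤ c ∧ ∀ s, c ≤ s → a * 2 ^ (-(b * s)) ≤ e := by
  have h1 : Filter.Tendsto (fun s : ℝ => a * (2:ℝ) ^ (-(b * s))) Filter.atTop (nhds (a * 0)) := by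
    apply Filter.Tendsto.const_mul
    have h2 := tendsto_rpow_atTop_of_base_lt_one (1/2 : ℝ) (by norm_num) (by norm_num)
    have h3 := h2.comp (Filter.tendsto_id.const_mul_atTop hb)
    refine h3.congr (fun s => ?_)
    simp [Real.rpow_neg, Real.inv_rpow]
  rw [mul_zero] at h1
  obtain ⟨c, hc⟩ := Filter.eventually_atTop.1 (h1.eventually (gt_mem_nhds he))
  exact ⟨max c 0, le_max_right _ _, fun s hs => (hc s ((le_max_left _ _).trans hs)).le⟩

theorem exists_shift {n : ℕ} (Θ : Cover n) : ∃ c : ℝ, 0 ≤ c ∧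
    ∀ (y z w : EuclideanSpace ℝ (Fin n)) (t t' : ℝ), t ≤ t' → y ∈ ell (Θ.M z t') z →
      w ∈ ell (Θ.M z t') z → w ∈ ell (Θ.M y (t - c)) y := by
  obtain ⟨c, hc0, hc⟩ := exists_decay Θ.a₅_pos Θ.a₆_pos (show (0:ℝ) < 1/2 by norm_num)
  refine ⟨c, hc0, fun y z w t t' htt hy hw => ?_⟩
  rw [ell_mem_iff _ (Θ.inv _ _)]
  have h1 := shape_vec Θ y z (t - c) t' (by linarith) ⟨y, ell_self Θ _ _, hy⟩ (w - y)
  have h2 := hc (t' - (t - c)) (by linarith)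
  rw [ell_mem_iff _ (Θ.inv _ _)] at hy hw
  have h3 : ‖Matrix.toEuclideanLin (Θ.M z t')⁻¹ (w - y)‖ ≤ 2 := by
    have : w - y = (w - z) - (y - z) := by abel
    rw [this, map_sub]
    exact (norm_sub_le _ _).trans (by linarith)
  calc _ ≤ _ := h1
    _ ≤ 1/2 * 2 := mul_le_mul h2 h3 (norm_nonneg _) (by norm_num)
    _ = 1 := by norm_num

theorem exists_center {n : ℕ} (Θ : Cover n) (x y : EuclideanSpace ℝ (Fin n)) :
    ∃ t, y ∈ ell (Θ.M x t) x := by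
  set N := ‖Matrix.toEuclideanLin (Θ.M x 0)⁻¹ (y - x)‖ with hN
  have hN0 : 0 ≤ N := norm_nonneg _
  obtain ⟨c, hc0, hc⟩ := exists_decay Θ.a₅_pos Θ.a₆_pos (show (0:ℝ) < 1/(N+1) by positivity)
  refine ⟨-c, ?_⟩
  rw [ell_mem_iff _ (Θ.inv _ _)]
  have h1 := shape_vec Θ x x (-c) 0 (by linarith) ⟨x, ell_self Θ _ _, ell_self Θ _ _⟩ (y - x)
  have h2 := hc (0 - -c) (by linarith)
  calc _ ≤ _ := h1
    _ ≤ 1/(N+1) * N := mul_le_mul_of_nonneg_right h2 hN0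
    _ ≤ 1 := by rw [div_mul_eq_mul_div, div_le_one (by positivity)]; linarith

theorem volR_nonneg {n : ℕ} (E : Set (EuclideanSpace ℝ (Fin n))) : 0 ≤ volR E :=
  ENNReal.toReal_nonneg

theorem rho1_le {n : ℕ} (Θ : Cover n) {x y : EuclideanSpace ℝ (Fin n)} {t : ℝ}
    (h : y ∈ ell (Θ.M x t) x) : rho1 Θ x y ≤ volR (ell (Θ.M x t) x) :=
  csInf_le ⟨0, by rintro _ ⟨t, -, rfl⟩; exact volR_nonneg _⟩ ⟨t, h, rfl⟩

theorem rhoCover_le {n : ℕ} (Θ : Cover n) {x y z : EuclideanSpace ℝ (Fin n)} {t : ℝ}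
    (hx : x ∈ ell (Θ.M z t) z) (hy : y ∈ ell (Θ.M z t) z) :
    rhoCover Θ x y ≤ volR (ell (Θ.M z t) z) :=
  csInf_le ⟨0, by rintro _ ⟨z, t, -, -, rfl⟩; exact volR_nonneg _⟩ ⟨z, t, hx, hy, rfl⟩

theorem le_rho1 {n : ℕ} (Θ : Cover n) {x y : EuclideanSpace ℝ (Fin n)} {b : ℝ}
    (h : ∀ t, y ∈ ell (Θ.M x t) x → b ≤ volR (ell (Θ.M x t) x)) : b ≤ rho1 Θ x y := by
  obtain ⟨t, ht⟩ := exists_center Θ x y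
  exact le_csInf ⟨_, t, ht, rfl⟩ (by rintro _ ⟨t, h', rfl⟩; exact h t h')

theorem rhoCover_lt {n : ℕ} (Θ : Cover n) {x y : EuclideanSpace ℝ (Fin n)} {b : ℝ}
    (hb : rhoCover Θ x y < b) : ∃ z t, x ∈ ell (Θ.M z t) z ∧ y ∈ ell (Θ.M z t) z ∧
      volR (ell (Θ.M z t) z) < b := by
  obtain ⟨t, ht⟩ := exists_center Θ x y
  obtain ⟨_, ⟨z, t, hx, hy, rfl⟩, h⟩ := exists_lt_of_csInf_lt
    (⟨_, x, t, ell_self Θ x t, ht, rfl⟩ : {v : ℝ | ∃ z t, x ∈ ell (Θ.M z t) z ∧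
      y ∈ ell (Θ.M z t) z ∧ v = volR (ell (Θ.M z t) z)}.Nonempty) hb
  exact ⟨z, t, hx, hy, h⟩

theorem rhoCover_le_rhoTilde {n : ℕ} (Θ : Cover n) (x y : EuclideanSpace ℝ (Fin n)) :
    rhoCover Θ x y ≤ rhoTilde Θ x y :=
  le_min (le_rho1 Θ fun t h => rhoCover_le Θ (ell_self Θ x t) h)
    (le_rho1 Θ fun t h => rhoCover_le Θ h (ell_self Θ y t))

theorem vol_shift {n : ℕ} (Θ : Cover n) (c : ℝ) (y z : EuclideanSpace ℝ (Fin n)) (t : ℝ) :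
    volR (ell (Θ.M y (t - c)) y) ≤ (Θ.a₂ / Θ.a₁ * 2 ^ c) * volR (ell (Θ.M z t) z) := by
  have h1 := Θ.vol_ub y (t - c)
  have h2 := Θ.vol_lb z t
  have ha := Θ.a₁_pos
  have hb := Θ.a₂_pos
  have h3 : (2:ℝ) ^ (-(t - c)) = 2 ^ c * 2 ^ (-t) := by
    rw [← Real.rpow_add (by norm_num)]; congr 1; ring
  calc _ ≤ _ := h1
    _ = (Θ.a₂ / Θ.a₁ * 2 ^ c) * (Θ.a₁ * 2 ^ (-t)) := by rw [h3]; field_simp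
    _ ≤ _ := mul_le_mul_of_nonneg_left h2 (by positivity)

theorem rhoTilde_le {n : ℕ} (Θ : Cover n) : ∃ C : ℝ, 1 ≤ C ∧
    (∀ x y, rhoTilde Θ x y ≤ C * rhoCover Θ x y) ∧
    (∀ x y z, rhoCover Θ x z ≤ C * (rhoCover Θ x y + rhoCover Θ y z)) := by
  obtain ⟨c, hc0, hc⟩ := exists_shift Θ
  have ha := Θ.a₁_pos
  have hb := Θ.a₂_pos
  set K := Θ.a₂ / Θ.a₁ * 2 ^ c with hK
  set C := max 1 K with hC
  have hC1 : 1 ≤ C := le_max_left _ _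
  have hC0 : 0 < C := by linarith
  have hv : ∀ y z t, volR (ell (Θ.M y (t - c)) y) ≤ C * volR (ell (Θ.M z t) z) := fun y z t =>
    (vol_shift Θ c y z t).trans (mul_le_mul_of_nonneg_right (le_max_right _ _) (volR_nonneg _))
  refine ⟨C, hC1, fun x y => ?_, fun x y z => ?_⟩
  · apply le_of_forall_pos_lt_add
    intro e he
    obtain ⟨z, t, hx, hy, h⟩ := rhoCover_lt Θ
      (show rhoCover Θ x y < rhoCover Θ x y + e / C by linarith [div_pos he hC0])
    calc rhoTilde Θ x y ≤ rho1 Θ x y := min_le_left _ _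
      _ ≤ _ := rho1_le Θ (hc x z y t t le_rfl hx hy)
      _ ≤ _ := hv x z t
      _ < C * (rhoCover Θ x y + e / C) := mul_lt_mul_of_pos_left h hC0
      _ = _ := by field_simp
  · apply le_of_forall_pos_lt_add
    intro e he
    have he2 : 0 < e / C / 2 := by positivity
    obtain ⟨p, t, hx, hy, h⟩ := rhoCover_lt Θ
      (show rhoCover Θ x y < rhoCover Θ x y + e / C / 2 by linarith)
    obtain ⟨q, s, hy', hz, h'⟩ := rhoCover_lt Θ
      (show rhoCover Θ y z < rhoCover Θ y z + e / C / 2 by linarith)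
    have hp := volR_nonneg (ell (Θ.M p t) p)
    have hq := volR_nonneg (ell (Θ.M q s) q)
    have key : rhoCover Θ x z ≤ C * (volR (ell (Θ.M p t) p) + volR (ell (Θ.M q s) q)) := by
      rcases le_total t s with hts | hts
      · have h1 := rhoCover_le Θ (hc y p x t t le_rfl hy hx) (hc y q z t s hts hy' hz)
        exact (h1.trans (hv y p t)).trans (mul_le_mul_of_nonneg_left (by linarith) hC0.le)
      · have h1 := rhoCover_le Θ (hc y p x s t hts hy hx) (hc y q z s s le_rfl hy' hz)
        exact (h1.trans (hv y q s)).trans (mul_le_mul_of_nonneg_left (by linarith) hC0.le)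
    calc _ ≤ _ := key
      _ < C * (rhoCover Θ x y + rhoCover Θ y z + e / C) :=
        mul_lt_mul_of_pos_left (by linarith) hC0
      _ = _ := by field_simp

theorem rho1_nonneg {n : ℕ} (Θ : Cover n) (x y : EuclideanSpace ℝ (Fin n)) : 0 ≤ rho1 Θ x y :=
  le_rho1 Θ fun _ _ => volR_nonneg _

theorem rho1_self {n : ℕ} (Θ : Cover n) (x : EuclideanSpace ℝ (Fin n)) : rho1 Θ x x = 0 := by
  refine le_antisymm (le_of_forall_pos_le_add fun e he => ?_) (rho1_nonneg Θ x x)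
  obtain ⟨c, -, hc⟩ := exists_decay Θ.a₂_pos one_pos he
  have h1 := hc c le_rfl
  rw [one_mul] at h1
  linarith [rho1_le Θ (ell_self Θ x c), Θ.vol_ub x c]

theorem rho1_eq {n : ℕ} (Θ : Cover n) {x y : EuclideanSpace ℝ (Fin n)} (h : rho1 Θ x y = 0) :
    x = y := by
  have h0 : ‖Matrix.toEuclideanLin (Θ.M x 0)⁻¹ (y - x)‖ = 0 := by
    refine le_antisymm (le_of_forall_pos_le_add fun e he => ?_) (norm_nonneg _)
    obtain ⟨c, hc0, hc⟩ := exists_decay Θ.a₅_pos Θ.a₆_pos he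
    by_contra hcon
    have h1 : Θ.a₁ * 2 ^ (-c) ≤ rho1 Θ x y := by
      refine le_rho1 Θ fun t ht => le_trans ?_ (Θ.vol_lb x t)
      refine mul_le_mul_of_nonneg_left ?_ Θ.a₁_pos.le
      refine Real.rpow_le_rpow_of_exponent_le (by norm_num) ?_
      by_contra! hlt
      have hct : c ≤ t := by linarith
      have h2 := shape_vec Θ x x 0 t (by linarith) ⟨x, ell_self Θ _ _, ell_self Θ _ _⟩ (y - x)
      have h3 := hc t hct
      rw [ell_mem_iff _ (Θ.inv _ _)] at ht
      rw [sub_zero] at h2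
      apply hcon
      rw [zero_add]
      calc _ ≤ _ := h2
        _ ≤ e * 1 := mul_le_mul h3 ht (norm_nonneg _) he.le
        _ = e := mul_one e
    have h2 : 0 < Θ.a₁ * (2:ℝ) ^ (-c) := mul_pos Θ.a₁_pos (by positivity)
    linarith
  have hd : IsUnit (Θ.M x 0).det := (Matrix.isUnit_iff_isUnit_det _).1 (Θ.inv x 0)
  have h1 : Matrix.toEuclideanLin (Θ.M x 0) (Matrix.toEuclideanLin (Θ.M x 0)⁻¹ (y - x)) = y - x := by
    simp [Matrix.toLpLin_apply, Matrix.mulVec_mulVec, Matrix.mul_nonsing_inv _ hd]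
  rw [norm_eq_zero.1 h0, map_zero] at h1
  exact (sub_eq_zero.1 h1.symm).symm

/-- `ρ̃_Θ` is a quasi-distance equivalent to `ρ_Θ`. -/
theorem stmt10 {n : ℕ} (Θ : Cover n) :
    (∃ κ : ℝ, 1 ≤ κ ∧ ∀ x y z : EuclideanSpace ℝ (Fin n),
      0 ≤ rhoTilde Θ x y ∧
      (rhoTilde Θ x y = 0 ↔ x = y) ∧
      rhoTilde Θ x y = rhoTilde Θ y x ∧
      rhoTilde Θ x z ≤ κ * (rhoTilde Θ x y + rhoTilde Θ y z)) ∧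
    (∃ C : ℝ, 1 ≤ C ∧ ∀ x y : EuclideanSpace ℝ (Fin n),
      C⁻¹ * rhoCover Θ x y ≤ rhoTilde Θ x y ∧
      rhoTilde Θ x y ≤ C * rhoCover Θ x y) := by
  obtain ⟨C, hC1, hC, htri⟩ := rhoTilde_le Θ
  have hC0 : 0 < C := by linarith
  have hnn : ∀ x y, 0 ≤ rhoTilde Θ x y := fun x y =>
    le_min (rho1_nonneg Θ x y) (rho1_nonneg Θ y x)
  refine ⟨⟨C * C, by nlinarith, fun x y z => ⟨hnn x y, ⟨fun h => ?_, ?_⟩, min_comm _ _, ?_⟩⟩,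
    ⟨C, hC1, fun x y => ⟨?_, hC x y⟩⟩⟩
  · rcases min_choice (rho1 Θ x y) (rho1 Θ y x) with h' | h'
    · exact rho1_eq Θ (h'.symm.trans h)
    · exact (rho1_eq Θ (h'.symm.trans h)).symm
  · rintro rfl
    simp [rhoTilde, rho1_self]
  · calc rhoTilde Θ x z ≤ C * rhoCover Θ x z := hC x z
      _ ≤ C * (C * (rhoCover Θ x y + rhoCover Θ y z)) :=
        mul_le_mul_of_nonneg_left (htri x y z) hC0.le
      _ ≤ C * (C * (rhoTilde Θ x y + rhoTilde Θ y z)) := by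
        gcongr <;> exact rhoCover_le_rhoTilde Θ _ _
      _ = _ := by ring
  · rw [inv_mul_le_iff₀ hC0]
    nlinarith [rhoCover_le_rhoTilde Θ x y, hnn x y]
end
end

section
/- Let ρ be a quasi-distance on ℝⁿ which is quasi-convex with constant Q ≥ 1, and for each x ∈ ℝⁿ, r > 0 let ξ_x^r be an ellipsoid centered at x with ξ_x^r ⊆ B_ρ(x,r) ⊆ Q·ξ_x^r. Then ρ satisfies the inner property (there exist a, b > 0 such that aλ^b(B_ρ(x,r)−x) ⊆ B_ρ(x,λr)−x for all x ∈ ℝⁿ, r > 0, λ ≥ 1) if and only if there exist constants a₁, b₁ > 0 such that a₁λ^{b₁}·ξ_x^r ⊆ ξ_x^{λr} for all x ∈ ℝⁿ, r > 0, λ ≥ 1 (dilation about the common center x). -/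
open MeasureTheory Set Pointwise Matrix

noncomputable section

/-- The ball of a quasi-distance `ρ`. -/
def ballQ {n : ℕ} (ρ : EuclideanSpace ℝ (Fin n) → EuclideanSpace ℝ (Fin n) → ℝ)
    (x : EuclideanSpace ℝ (Fin n)) (r : ℝ) : Set (EuclideanSpace ℝ (Fin n)) :=
  {y | ρ x y < r}

/-- For a quasi-convex quasi-distance `ρ` with associated ellipsoids `ξ_x^r`, the
inner property of `ρ` is equivalent to the inner property of the ellipsoid family:
`a₁λ^{b₁}·ξ_x^r ⊆ ξ_x^{λr}`. -/
theorem stmt12 {n : ℕ}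
    (ρ : EuclideanSpace ℝ (Fin n) → EuclideanSpace ℝ (Fin n) → ℝ)
    (hnn : ∀ x y, 0 ≤ ρ x y)
    (hzero : ∀ x y, ρ x y = 0 ↔ x = y)
    (hsymm : ∀ x y, ρ x y = ρ y x)
    (κ : ℝ) (hκ : 1 ≤ κ)
    (htri : ∀ x y z, ρ x z ≤ κ * (ρ x y + ρ y z))
    (Q : ℝ) (hQ : 1 ≤ Q)
    (ξM : EuclideanSpace ℝ (Fin n) → ℝ → Matrix (Fin n) (Fin n) ℝ)
    (hξ_inv : ∀ x r, 0 < r → IsUnit (ξM x r))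
    (hξ_sub : ∀ x r, 0 < r → ell (ξM x r) x ⊆ ballQ ρ x r)
    (hξ_sup : ∀ x r, 0 < r → ballQ ρ x r ⊆ ell (Q • ξM x r) x)
 :
    (∃ a b : ℝ, 0 < a ∧ 0 < b ∧ ∀ (x : EuclideanSpace ℝ (Fin n)) (r lam : ℝ),
      0 < r → 1 ≤ lam →
      (a * lam ^ b) • ((fun z => z - x) '' ballQ ρ x r)
        ⊆ (fun z => z - x) '' ballQ ρ x (lam * r))
    ↔ (∃ a₁ b₁ : ℝ, 0 < a₁ ∧ 0 < b₁ ∧ ∀ (x : EuclideanSpace ℝ (Fin n)) (r lam : ℝ),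
      0 < r → 1 ≤ lam →
      ell ((a₁ * lam ^ b₁) • ξM x r) x ⊆ ell (ξM x (lam * r)) x) := by
  have hQ0 : Q ≠ 0 := by positivity
  have hell : ∀ (t : ℝ) (M : Matrix (Fin n) (Fin n) ℝ) (c y : EuclideanSpace ℝ (Fin n)),
      y ∈ ell (t • M) c ↔ ∃ z ∈ Metric.closedBall (0 : EuclideanSpace ℝ (Fin n)) 1,
        t • Matrix.toEuclideanLin M z + c = y := by
    intro t M c y
    simp only [ell, Set.mem_image, map_smul, LinearMap.smul_apply]
  constructor
  · rintro ⟨a, b, ha, hb, h⟩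
    refine ⟨a / Q, b, by positivity, hb, ?_⟩
    intro x r lam hr hl y hy
    obtain ⟨z, hz, rfl⟩ := (hell _ _ _ _).1 hy
    have h1 : Matrix.toEuclideanLin (ξM x r) z + x ∈ ballQ ρ x r :=
      hξ_sub x r hr ⟨z, hz, rfl⟩
    have h2 := h x r lam hr hl (Set.smul_mem_smul_set (Set.mem_image_of_mem _ h1))
    obtain ⟨u, hu, hu2⟩ := h2
    obtain ⟨w, hw, rfl⟩ := (hell _ _ _ _).1 (hξ_sup x (lam * r) (by positivity) hu)
    simp only [add_sub_cancel_right] at hu2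
    refine ⟨w, hw, ?_⟩
    have h3 : Matrix.toEuclideanLin (ξM x (lam * r)) w
        = (a / Q * lam ^ b) • Matrix.toEuclideanLin (ξM x r) z := by
      have h4 := congrArg (fun v => Q⁻¹ • v) hu2
      simp only [smul_smul, inv_mul_cancel₀ hQ0, one_smul] at h4
      rw [h4]
      congr 1
      ring
    simp only [h3]
  · rintro ⟨a, b, ha, hb, h⟩
    refine ⟨a / Q, b, by positivity, hb, ?_⟩
    intro x r lam hr hl v hv
    obtain ⟨_, ⟨y, hy, rfl⟩, rfl⟩ := hv
    obtain ⟨z, hz, rfl⟩ := (hell _ _ _ _).1 (hξ_sup x r hr hy)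
    refine ⟨(a * lam ^ b) • Matrix.toEuclideanLin (ξM x r) z + x, ?_, ?_⟩
    · exact hξ_sub x (lam * r) (by positivity)
        (h x r lam hr hl ((hell _ _ _ _).2 ⟨z, hz, rfl⟩))
    · simp only [add_sub_cancel_right, smul_smul]
      congr 1
      field_simp
end
end

section
/- Let ρ be a quasi-distance on ℝⁿ which is quasi-convex and 1-Ahlfors-regular. Then ρ satisfies the inner property: there exist constants a, b > 0 such that for all x ∈ ℝⁿ, r > 0, and λ ≥ 1, aλ^b(B_ρ(x,r)−x) ⊆ B_ρ(x,λr)−x. -/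
open MeasureTheory Set Pointwise Matrix

noncomputable section

/-- A quasi-convex, 1-Ahlfors-regular quasi-distance on `ℝⁿ` automatically
satisfies the inner property:
`aλ^b (B_ρ(x,r) − x) ⊆ B_ρ(x,λr) − x` for all `x`, `r > 0`, `λ ≥ 1`. -/
theorem stmt14 {n : ℕ}
    (ρ : EuclideanSpace ℝ (Fin n) → EuclideanSpace ℝ (Fin n) → ℝ)
    (hnn : ∀ x y, 0 ≤ ρ x y)
    (hzero : ∀ x y, ρ x y = 0 ↔ x = y)
    (hsymm : ∀ x y, ρ x y = ρ y x)
    (κ : ℝ) (hκ : 1 ≤ κ)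
    (htri : ∀ x y z, ρ x z ≤ κ * (ρ x y + ρ y z))
    (Q : ℝ) (hQ : 1 ≤ Q)
    (ξM : EuclideanSpace ℝ (Fin n) → ℝ → Matrix (Fin n) (Fin n) ℝ)
    (hξ_inv : ∀ x r, 0 < r → IsUnit (ξM x r))
    (hξ_sub : ∀ x r, 0 < r → ell (ξM x r) x ⊆ ballQ ρ x r)
    (hξ_sup : ∀ x r, 0 < r → ballQ ρ x r ⊆ ell (Q • ξM x r) x)
    (c₁ : ℝ) (hc₁ : 1 ≤ c₁)
    (hAhl : ∀ x r, 0 < r → r / c₁ ≤ volR (ballQ ρ x r) ∧ volR (ballQ ρ x r) ≤ c₁ * r)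
 :
    ∃ a b : ℝ, 0 < a ∧ 0 < b ∧ ∀ (x : EuclideanSpace ℝ (Fin n)) (r lam : ℝ),
      0 < r → 1 ≤ lam →
      (a * lam ^ b) • ((fun z => z - x) '' ballQ ρ x r)
        ⊆ (fun z => z - x) '' ballQ ρ x (lam * r) := by
  have hQ0 : 0 < Q := by linarith
  have shrink : ∀ (x v : EuclideanSpace ℝ (Fin n)) (r t : ℝ), 0 < r → |t| ≤ 1 / Q →
      ρ x (x + v) < r → ρ x (x + t • v) < r := by
    intro x v r t hr ht hv
    obtain ⟨z, hz, hzv⟩ := hξ_sup x r hr hv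
    have hv' : v = Q • Matrix.toEuclideanLin (ξM x r) z := by
      have h1 : Matrix.toEuclideanLin (Q • ξM x r) z + x = x + v := hzv
      rw [map_smul, LinearMap.smul_apply, add_comm x v] at h1
      exact (add_right_cancel h1).symm
    have hmem : x + t • v ∈ ell (ξM x r) x := by
      refine ⟨(t * Q) • z, ?_, ?_⟩
      · rw [mem_closedBall_zero_iff] at hz ⊢
        rw [norm_smul, Real.norm_eq_abs, abs_mul, abs_of_pos hQ0]
        have h2 : |t| * Q ≤ 1 := by
          rwa [le_div_iff₀ hQ0] at ht
        have h3 : 0 ≤ |t| * Q := by positivity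
        nlinarith [norm_nonneg z]
      · simp only [map_smul]
        rw [hv', smul_smul, add_comm]
    exact hξ_sub x r hr hmem
  have step : ∀ (x v : EuclideanSpace ℝ (Fin n)) (r : ℝ), 0 < r →
      ρ x (x + v) < r → ρ x (x + (1 + 1 / Q) • v) < (2 * κ) * r := by
    intro x v r hr hv
    have h1 : ρ (x + v) ((x + v) + (-v)) < r := by
      rw [add_neg_cancel_right, hsymm]; exact hv
    have h2 := shrink (x + v) (-v) r (-(1 / Q)) hr
      (by rw [abs_neg, abs_of_pos (by positivity)]) h1
    have h3 : x + (1 + 1 / Q) • v = (x + v) + (-(1 / Q)) • (-v) := by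
      rw [neg_smul_neg, add_smul, one_smul, add_assoc]
    rw [h3]
    refine (htri x (x + v) _).trans_lt ?_
    nlinarith
  set θ : ℝ := 1 + 1 / Q with hθ
  have hθ1 : 1 < θ := by
    have : 0 < 1 / Q := by positivity
    linarith
  have hL1 : 1 < 2 * κ := by linarith
  have iter : ∀ (k : ℕ) (x v : EuclideanSpace ℝ (Fin n)) (r : ℝ), 0 < r →
      ρ x (x + v) < r → ρ x (x + θ ^ k • v) < (2 * κ) ^ k * r := by
    intro k x v r hr hv
    induction k with
    | zero => simpa using hv
    | succ k ih =>
      have h := step x (θ ^ k • v) ((2 * κ) ^ k * r) (by positivity) ih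
      rw [smul_smul] at h
      rw [pow_succ', pow_succ', mul_assoc]
      exact h
  have hlL : 0 < Real.log (2 * κ) := Real.log_pos hL1
  have hlθ : 0 < Real.log θ := Real.log_pos hθ1
  refine ⟨1 / (θ * Q), Real.log θ / Real.log (2 * κ), by positivity, by positivity, ?_⟩
  intro x r lam hr hlam
  rintro _ ⟨_, ⟨y, hy, rfl⟩, rfl⟩
  obtain ⟨k, hk1, hk2⟩ := exists_nat_pow_near hlam hL1
  set b := Real.log θ / Real.log (2 * κ) with hb
  have hb0 : 0 < b := by positivity
  have hLb : (2 * κ) ^ b = θ := by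
    rw [Real.rpow_def_of_pos (by linarith), hb, mul_div_cancel₀ _ hlL.ne',
      Real.exp_log (by linarith)]
  have hlamb : lam ^ b ≤ θ ^ (k + 1) := by
    calc lam ^ b ≤ ((2 * κ) ^ (k + 1)) ^ b :=
          Real.rpow_le_rpow (by linarith) hk2.le hb0.le
      _ = θ ^ (k + 1) := by
          rw [← Real.rpow_natCast, ← Real.rpow_mul (by linarith), mul_comm _ b,
            Real.rpow_mul (by linarith), hLb, Real.rpow_natCast]
  have hθk : 0 < θ ^ k := by positivity
  have hlp : 0 < lam ^ b := Real.rpow_pos_of_pos (by linarith) _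
  have hy' : ρ x (x + (y - x)) < r := by
    rw [add_sub_cancel]; exact hy
  have h1 := iter k x (y - x) r hr hy'
  have h2 := shrink x _ _ (1 / (θ * Q) * lam ^ b / θ ^ k) (by positivity) (by
    rw [abs_of_pos (by positivity), div_le_iff₀ hθk]
    calc 1 / (θ * Q) * lam ^ b ≤ 1 / (θ * Q) * θ ^ (k + 1) := by gcongr
      _ = 1 / Q * θ ^ k := by
        have : θ ≠ 0 := by positivity
        rw [pow_succ]; field_simp) h1
  rw [smul_smul, div_mul_cancel₀ _ hθk.ne'] at h2
  refine ⟨_, lt_of_lt_of_le h2 ?_, add_sub_cancel_left _ _⟩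
  gcongr
end
end

section
/- Let ρ be a quasi-distance on ℝⁿ which is quasi-convex with constant Q ≥ 1 and 1-Ahlfors-regular, and for each x ∈ ℝⁿ, r > 0 let ξ_x^r be an ellipsoid centered at x with ξ_x^r ⊆ B_ρ(x,r) ⊆ Q·ξ_x^r; set Ξ = {ξ_x^r : x ∈ ℝⁿ, r > 0}. Define ρ_Ξ(x,y) := inf{|ξ| : ξ ∈ Ξ, x, y ∈ ξ}. Then ρ_Ξ is equivalent to ρ: there exists a constant C ≥ 1 such that C⁻¹ρ(x,y) ≤ ρ_Ξ(x,y) ≤ Cρ(x,y) for all x, y ∈ ℝⁿ. -/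
open MeasureTheory Set Pointwise Matrix

noncomputable section

theorem mem_ell_iff {n : ℕ} (M : Matrix (Fin n) (Fin n) ℝ) (c y : EuclideanSpace ℝ (Fin n)) :
    y ∈ ell M c ↔ ∃ z, ‖z‖ ≤ 1 ∧ Matrix.toEuclideanLin M z + c = y := by
  simp [ell]

theorem ell_smul {n : ℕ} (M : Matrix (Fin n) (Fin n) ℝ) (c : EuclideanSpace ℝ (Fin n)) (Q : ℝ) :
    ell (Q • M) c = AffineMap.homothety c Q '' ell M c := by
  unfold ell
  rw [Set.image_image]
  refine Set.image_congr fun z _ => ?_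
  simp [AffineMap.homothety_apply]

theorem volR_ell_smul {n : ℕ} (M : Matrix (Fin n) (Fin n) ℝ) (c : EuclideanSpace ℝ (Fin n))
    (Q : ℝ) (hQ : 0 ≤ Q) : volR (ell (Q • M) c) = Q ^ n * volR (ell M c) := by
  rw [ell_smul, volR, volR, Measure.addHaar_image_homothety]
  simp [abs_of_nonneg hQ, hQ]

theorem ell_fin {n : ℕ} (M : Matrix (Fin n) (Fin n) ℝ) (c : EuclideanSpace ℝ (Fin n)) :
    volume (ell M c) ≠ ⊤ := by
  refine (IsCompact.measure_lt_top ?_).ne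
  refine (isCompact_closedBall _ _).image ?_
  exact ((Matrix.toEuclideanLin M).continuous_of_finiteDimensional).add continuous_const

theorem step_aux {n : ℕ}
    (ρ : EuclideanSpace ℝ (Fin n) → EuclideanSpace ℝ (Fin n) → ℝ)
    (hzero : ∀ x y, ρ x y = 0 ↔ x = y)
    (hsymm : ∀ x y, ρ x y = ρ y x)
    (κ : ℝ) (hκ : 1 ≤ κ)
    (htri : ∀ x y z, ρ x z ≤ κ * (ρ x y + ρ y z))
    (Q : ℝ) (hQ : 1 ≤ Q)
    (ξM : EuclideanSpace ℝ (Fin n) → ℝ → Matrix (Fin n) (Fin n) ℝ)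
    (hξ_sub : ∀ x r, 0 < r → ell (ξM x r) x ⊆ ballQ ρ x r)
    (hξ_sup : ∀ x r, 0 < r → ballQ ρ x r ⊆ ell (Q • ξM x r) x)
    (x : EuclideanSpace ℝ (Fin n)) (s : ℝ) (hs : 0 < s)
    (z : EuclideanSpace ℝ (Fin n)) (hz : ‖z‖ ≤ 1) (k : ℕ) :
    ρ x (x + ((k : ℝ) / Q) • Matrix.toEuclideanLin (ξM x s) z) < (κ * (1 + 2 * κ)) ^ k * s := by
  have hQ0 : Q ≠ 0 := by positivity
  induction k with
  | zero => simpa [(hzero x x).2 rfl] using hs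
  | succ k ih =>
    set a : ℝ := (κ * (1 + 2 * κ)) ^ k with ha
    have ha1 : 1 ≤ a := one_le_pow₀ (by nlinarith)
    set m := Matrix.toEuclideanLin (ξM x s) z with hm
    set p := x + ((k : ℝ) / Q) • m with hp
    have hR : 0 < 2 * κ * a * s := by positivity
    have key : ∀ w, ρ x w < s → w ∈ ell (Q • ξM p (2 * κ * a * s)) p := by
      intro w hw
      apply hξ_sup _ _ hR
      show ρ p w < _
      have h1 := htri p x w
      rw [hsymm p x] at h1
      have h2 : ρ x p + ρ x w < 2 * (a * s) := by nlinarith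
      nlinarith
    have hin : ∀ u : EuclideanSpace ℝ (Fin n), ‖u‖ ≤ 1 →
        ρ x (Matrix.toEuclideanLin (ξM x s) u + x) < s := fun u hu =>
      hξ_sub x s hs ((mem_ell_iff _ _ _).2 ⟨u, hu, rfl⟩)
    obtain ⟨u, hu, hu'⟩ := (mem_ell_iff _ _ _).1 (key _ (hin z hz))
    obtain ⟨v, hv, hv'⟩ := (mem_ell_iff _ _ _).1 (key _ (hin (-z) (by simpa using hz)))
    simp only [map_neg, ← hm, map_smul, LinearMap.smul_apply] at hu' hv'
    set L := Matrix.toEuclideanLin (ξM p (2 * κ * a * s)) with hL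
    have hLm : L ((1 / 2 : ℝ) • (u - v)) = (1 / Q) • m := by
      have : Q • (L u - L v) = (2 : ℝ) • m := by
        have : Q • L u - Q • L v = (2 : ℝ) • m := by
          rw [eq_sub_of_add_eq hu', eq_sub_of_add_eq hv']; module
        rw [smul_sub, this]
      have h3 : L u - L v = (2 / Q) • m := by
        have := congrArg (fun t => (1 / Q) • t) this
        simp only [smul_smul] at this
        rw [one_div_mul_cancel hQ0, one_smul] at this
        rw [this]; congr 1; ring
      rw [map_smul, map_sub, h3, smul_smul]; congr 1; ring
    have hn : ‖(1 / 2 : ℝ) • (u - v)‖ ≤ 1 := by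
      rw [norm_smul]
      have := norm_sub_le u v
      norm_num
      linarith
    have h4 : ρ p (L ((1 / 2 : ℝ) • (u - v)) + p) < 2 * κ * a * s :=
      hξ_sub p _ hR ((mem_ell_iff _ _ _).2 ⟨_, hn, rfl⟩)
    rw [hLm] at h4
    have h5 : (1 / Q) • m + p = x + (((k + 1 : ℕ) : ℝ) / Q) • m := by
      rw [hp]; push_cast; module
    rw [h5] at h4
    have h6 := htri x p (x + (((k + 1 : ℕ) : ℝ) / Q) • m)
    refine h6.trans_lt ?_
    rw [pow_succ, ← ha]
    have : ρ x p + ρ p (x + (((k + 1 : ℕ) : ℝ) / Q) • m) < a * s + 2 * κ * a * s := by linarith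
    calc _ < κ * (a * s + 2 * κ * a * s) := by gcongr
      _ = _ := by ring

theorem engulf {n : ℕ}
    (ρ : EuclideanSpace ℝ (Fin n) → EuclideanSpace ℝ (Fin n) → ℝ)
    (hzero : ∀ x y, ρ x y = 0 ↔ x = y)
    (hsymm : ∀ x y, ρ x y = ρ y x)
    (κ : ℝ) (hκ : 1 ≤ κ)
    (htri : ∀ x y z, ρ x z ≤ κ * (ρ x y + ρ y z))
    (Q : ℝ) (hQ : 1 ≤ Q)
    (ξM : EuclideanSpace ℝ (Fin n) → ℝ → Matrix (Fin n) (Fin n) ℝ)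
    (hξ_sub : ∀ x r, 0 < r → ell (ξM x r) x ⊆ ballQ ρ x r)
    (hξ_sup : ∀ x r, 0 < r → ballQ ρ x r ⊆ ell (Q • ξM x r) x) :
    ∃ A : ℝ, 1 ≤ A ∧ ∀ x s, 0 < s → ballQ ρ x s ⊆ ell (ξM x (A * s)) x := by
  have hQ0 : Q ≠ 0 := by positivity
  set N := ⌈Q ^ 3⌉₊ with hN
  have hNQ : Q ^ 3 ≤ N := Nat.le_ceil _
  have hN0 : (0 : ℝ) < N := lt_of_lt_of_le (by positivity) hNQ
  have hA : 1 ≤ (κ * (1 + 2 * κ)) ^ N := one_le_pow₀ (by nlinarith)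
  refine ⟨(κ * (1 + 2 * κ)) ^ N, hA, fun x s hs y hy => ?_⟩
  obtain ⟨z, hz, rfl⟩ := (mem_ell_iff _ _ _).1 (hξ_sup x s hs hy)
  have hz' : ‖(Q ^ 3 / N : ℝ) • z‖ ≤ 1 := by
    rw [norm_smul, Real.norm_of_nonneg (by positivity)]
    exact mul_le_one₀ ((div_le_one hN0).2 hNQ) (norm_nonneg _) hz
  have h := step_aux ρ hzero hsymm κ hκ htri Q hQ ξM hξ_sub hξ_sup x s hs _ hz' N
  obtain ⟨w, hw, hw'⟩ := (mem_ell_iff _ _ _).1 (hξ_sup x _ (by positivity) h)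
  refine (mem_ell_iff _ _ _).2 ⟨w, hw, ?_⟩
  simp only [map_smul, LinearMap.smul_apply, smul_smul] at hw' ⊢
  rw [add_comm x] at hw'
  have h1 := congrArg (fun t => (1 / Q) • t) (add_right_cancel hw')
  simp only [smul_smul] at h1
  rw [one_div_mul_cancel hQ0, one_smul] at h1
  rw [h1]
  congr 2
  field_simp

/-- For a quasi-convex, 1-Ahlfors-regular quasi-distance `ρ` with associated family
of ellipsoids `Ξ = {ξ_x^r}`, the induced quasi-distance
`ρ_Ξ(x,y) = inf{|ξ| : ξ ∈ Ξ, x,y ∈ ξ}` is equivalent to `ρ`. -/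
theorem stmt16 {n : ℕ}
    (ρ : EuclideanSpace ℝ (Fin n) → EuclideanSpace ℝ (Fin n) → ℝ)
    (hnn : ∀ x y, 0 ≤ ρ x y)
    (hzero : ∀ x y, ρ x y = 0 ↔ x = y)
    (hsymm : ∀ x y, ρ x y = ρ y x)
    (κ : ℝ) (hκ : 1 ≤ κ)
    (htri : ∀ x y z, ρ x z ≤ κ * (ρ x y + ρ y z))
    (Q : ℝ) (hQ : 1 ≤ Q)
    (ξM : EuclideanSpace ℝ (Fin n) → ℝ → Matrix (Fin n) (Fin n) ℝ)
    (hξ_inv : ∀ x r, 0 < r → IsUnit (ξM x r))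
    (hξ_sub : ∀ x r, 0 < r → ell (ξM x r) x ⊆ ballQ ρ x r)
    (hξ_sup : ∀ x r, 0 < r → ballQ ρ x r ⊆ ell (Q • ξM x r) x)
    (c₁ : ℝ) (hc₁ : 1 ≤ c₁)
    (hAhl : ∀ x r, 0 < r → r / c₁ ≤ volR (ballQ ρ x r) ∧ volR (ballQ ρ x r) ≤ c₁ * r)
 :
    ∃ C : ℝ, 1 ≤ C ∧ ∀ x y : EuclideanSpace ℝ (Fin n),
      C⁻¹ * ρ x y ≤
        sInf {v : ℝ | ∃ z r, 0 < r ∧ x ∈ ell (ξM z r) z ∧ y ∈ ell (ξM z r) z ∧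
          v = volR (ell (ξM z r) z)} ∧
      sInf {v : ℝ | ∃ z r, 0 < r ∧ x ∈ ell (ξM z r) z ∧ y ∈ ell (ξM z r) z ∧
          v = volR (ell (ξM z r) z)} ≤ C * ρ x y := by
  obtain ⟨A, hA, hE⟩ := engulf ρ hzero hsymm κ hκ htri Q hQ ξM hξ_sub hξ_sup
  have hQ0 : 0 < Q := by positivity
  have hQn : 1 ≤ Q ^ n := one_le_pow₀ hQ
  have hmem : ∀ x s, 0 < s → x ∈ ell (ξM x s) x := fun x s hs =>
    (mem_ell_iff _ _ _).2 ⟨0, by simp, by simp⟩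
  have hup : ∀ z r, 0 < r → volR (ell (ξM z r) z) ≤ c₁ * r := by
    intro z r hr
    refine le_trans ?_ (hAhl z r hr).2
    exact ENNReal.toReal_mono (measure_ne_top_of_subset (hξ_sup z r hr) (ell_fin _ _))
      (measure_mono (hξ_sub z r hr))
  have hlow : ∀ z r, 0 < r → r ≤ c₁ * Q ^ n * volR (ell (ξM z r) z) := by
    intro z r hr
    have h1 := (hAhl z r hr).1
    have h2 : volR (ballQ ρ z r) ≤ volR (ell (Q • ξM z r) z) :=
      ENNReal.toReal_mono (ell_fin _ _) (measure_mono (hξ_sup z r hr))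
    rw [volR_ell_smul _ _ _ hQ0.le] at h2
    rw [div_le_iff₀ (by positivity)] at h1
    nlinarith
  have hC1 : 1 ≤ c₁ * A := one_le_mul_of_one_le_of_one_le hc₁ hA
  have hC2 : 0 < 2 * κ * (c₁ * Q ^ n) := by positivity
  refine ⟨2 * κ * (c₁ * Q ^ n) + c₁ * A, by linarith, fun x y => ⟨?_, ?_⟩⟩
  · apply le_csInf
    · have hs : 0 < ρ x y + 1 := by linarith [hnn x y]
      exact ⟨_, x, A * (ρ x y + 1), by positivity, hmem _ _ (by positivity),
        hE x _ hs (show ρ x y < ρ x y + 1 by linarith), rfl⟩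
    · rintro v ⟨z, r, hr, hx, hy, rfl⟩
      have hx' : ρ z x < r := hξ_sub z r hr hx
      have hy' : ρ z y < r := hξ_sub z r hr hy
      have h1 := htri x z y
      rw [hsymm x z] at h1
      have h2 : ρ x y ≤ 2 * κ * r := by nlinarith
      have h3 := hlow z r hr
      have hv : 0 ≤ volR (ell (ξM z r) z) := ENNReal.toReal_nonneg
      rw [inv_mul_le_iff₀ (by positivity)]
      have h4 : 2 * κ * r ≤ 2 * κ * (c₁ * Q ^ n * volR (ell (ξM z r) z)) := by gcongr
      have h5 : 0 ≤ c₁ * A * volR (ell (ξM z r) z) := by positivity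
      nlinarith
  · have hS : ∀ s, ρ x y < s → sInf {v : ℝ | ∃ z r, 0 < r ∧ x ∈ ell (ξM z r) z ∧
        y ∈ ell (ξM z r) z ∧ v = volR (ell (ξM z r) z)} ≤ c₁ * A * s := by
      intro s hs
      have hs0 : 0 < s := (hnn x y).trans_lt hs
      have hAs : 0 < A * s := by positivity
      refine le_trans (csInf_le ⟨0, ?_⟩ ⟨x, A * s, hAs, hmem _ _ hAs, hE x s hs0 hs, rfl⟩) ?_
      · rintro v ⟨z, r, hr, hx, hy, rfl⟩
        exact ENNReal.toReal_nonneg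
      · rw [mul_assoc]; exact hup _ _ hAs
    have hpos : 0 < c₁ * A := by positivity
    have h6 : sInf {v : ℝ | ∃ z r, 0 < r ∧ x ∈ ell (ξM z r) z ∧
        y ∈ ell (ξM z r) z ∧ v = volR (ell (ξM z r) z)} ≤ c₁ * A * ρ x y := by
      rw [← div_le_iff₀' hpos]
      refine le_of_forall_gt_imp_ge_of_dense fun s hs => ?_
      rw [div_le_iff₀' hpos]
      exact hS s hs
    have h7 := mul_nonneg hC2.le (hnn x y)
    rw [add_mul]
    linarith
end
end

section
/- In ℝ², for x = (x₁,x₂) ∈ ℝ² and t ∈ ℝ define the ellipse θ_{x,t} := {z = (z₁,z₂) ∈ ℝ² : (z₁−x₁)²/σ₁² + (z₂−x₂)²/σ₂² ≤ 1}, where the semi-axes are: σ₁ = σ₂ = 2^{−t/2} if t ≤ 0; σ₁ = σ₂ = 2^{−t/2} if t > 0 and |x₂| > 2^{−t/3}; σ₁ = 2^{−5t/6}/|x₂| and σ₂ = 2^{−t/6}|x₂| if t > 0 and 2^{−t/2} < |x₂| ≤ 2^{−t/3}; σ₁ = 2^{−t/3} and σ₂ = 2^{−2t/3} if t > 0 and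 |x₂| ≤ 2^{−t/2}. Then Θ₀ = {θ_{x,t} : x ∈ ℝ², t ∈ ℝ} is a continuous ellipsoid cover of ℝ²: its ellipses satisfy a₁2^{−t} ≤ |θ_{x,t}| ≤ a₂2^{−t} for some a₁, a₂ > 0, and there exist positive constants a₃, a₄, a₅, a₆ such that whenever θ_{x,t} ∩ θ_{y,t+s} ≠ ∅ with s ≥ 0, one has a₃2^{−a₄s} ≤ 1/‖(M_{y,t+s})⁻¹M_{x,t}‖ ≤ ‖(M_{x,t})⁻¹M_{y,t+s}‖ ≤ a₅2^{−a₆s}, where M_{x,t} = diag(σ₁,σ₂) is the matrix with θ_{x,t} = M_{x,t}(𝔹²)+x. -/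
open MeasureTheory Set Pointwise Matrix

noncomputable section

/-- Semi-axis `σ₁` of the ellipse `θ_{x,t}` of the cover `Θ₀` of `ℝ²`. -/
def sig1 (x₂ t : ℝ) : ℝ :=
  if t ≤ 0 then 2 ^ (-t / 2)
  else if 2 ^ (-t / 3) < |x₂| then 2 ^ (-t / 2)
  else if 2 ^ (-t / 2) < |x₂| then 2 ^ (-(5 * t) / 6) / |x₂|
  else 2 ^ (-t / 3)

/-- Semi-axis `σ₂` of the ellipse `θ_{x,t}` of the cover `Θ₀` of `ℝ²`. -/
def sig2 (x₂ t : ℝ) : ℝ :=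
  if t ≤ 0 then 2 ^ (-t / 2)
  else if 2 ^ (-t / 3) < |x₂| then 2 ^ (-t / 2)
  else if 2 ^ (-t / 2) < |x₂| then 2 ^ (-t / 6) * |x₂|
  else 2 ^ (-(2 * t) / 3)

/-- The matrix `M_{x,t} = diag(σ₁, σ₂)` of the cover `Θ₀`. -/
def M0 (x : EuclideanSpace ℝ (Fin 2)) (t : ℝ) : Matrix (Fin 2) (Fin 2) ℝ :=
  Matrix.diagonal ![sig1 (x 1) t, sig2 (x 1) t]

theorem exists_m (a t : ℝ) : ∃ m : ℝ, 0 < m ∧ sig1 a t = 2 ^ (-(5 * t) / 6) / m ∧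
    sig2 a t = 2 ^ (-t / 6) * m ∧ (t ≤ 0 → m = 2 ^ (-t / 3)) ∧
    (0 < t → 2 ^ (-t / 2) ≤ m ∧ m ≤ 2 ^ (-t / 3) ∧ (m = 2 ^ (-t / 3) ∨ |a| ≤ m) ∧
      (m = 2 ^ (-t / 2) ∨ m ≤ |a|)) := by
  have h2 : (0 : ℝ) < 2 := by norm_num
  have h1 : (1 : ℝ) ≤ 2 := by norm_num
  have e1 : (2 : ℝ) ^ (-t / 2) = 2 ^ (-(5 * t) / 6) / 2 ^ (-t / 3) := by
    rw [← Real.rpow_sub h2]; congr 1; ring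
  have e2 : (2 : ℝ) ^ (-t / 2) = 2 ^ (-t / 6) * 2 ^ (-t / 3) := by
    rw [← Real.rpow_add h2]; congr 1; ring
  have e3 : (2 : ℝ) ^ (-t / 3) = 2 ^ (-(5 * t) / 6) / 2 ^ (-t / 2) := by
    rw [← Real.rpow_sub h2]; congr 1; ring
  have e4 : (2 : ℝ) ^ (-(2 * t) / 3) = 2 ^ (-t / 6) * 2 ^ (-t / 2) := by
    rw [← Real.rpow_add h2]; congr 1; ring
  have p2 : (0 : ℝ) < 2 ^ (-t / 2) := by positivity
  have p3 : (0 : ℝ) < 2 ^ (-t / 3) := by positivity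
  unfold sig1 sig2
  by_cases c1 : t ≤ 0
  · simp only [if_pos c1]
    exact ⟨2 ^ (-t / 3), p3, e1, e2, fun _ => rfl, fun h => absurd c1 (not_le.2 h)⟩
  have hm : (2 : ℝ) ^ (-t / 2) ≤ 2 ^ (-t / 3) :=
    Real.rpow_le_rpow_of_exponent_le h1 (by linarith)
  simp only [if_neg c1]
  by_cases c2 : 2 ^ (-t / 3) < |a|
  · simp only [if_pos c2]
    exact ⟨2 ^ (-t / 3), p3, e1, e2, fun h => absurd h c1,
      fun _ => ⟨hm, le_rfl, Or.inl rfl, Or.inr c2.le⟩⟩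
  simp only [if_neg c2]
  by_cases c3 : 2 ^ (-t / 2) < |a|
  · simp only [if_pos c3]
    exact ⟨|a|, p2.trans c3, rfl, rfl, fun h => absurd h c1,
      fun _ => ⟨c3.le, not_lt.1 c2, Or.inr le_rfl, Or.inr le_rfl⟩⟩
  · simp only [if_neg c3]
    exact ⟨2 ^ (-t / 2), p2, e3, e4, fun h => absurd h c1,
      fun _ => ⟨le_rfl, hm, Or.inr (not_lt.1 c3), Or.inl rfl⟩⟩

theorem m_bounds (a b t s m k : ℝ) (hs : 0 ≤ s) (hm : 0 < m) (hk : 0 < k)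
    (hm0 : t ≤ 0 → m = 2 ^ (-t / 3))
    (hm1 : 0 < t → 2 ^ (-t / 2) ≤ m ∧ m ≤ 2 ^ (-t / 3) ∧ (m = 2 ^ (-t / 3) ∨ |a| ≤ m) ∧
      (m = 2 ^ (-t / 2) ∨ m ≤ |a|))
    (hk0 : t + s ≤ 0 → k = 2 ^ (-(t + s) / 3))
    (hk1 : 0 < t + s → 2 ^ (-(t + s) / 2) ≤ k ∧ k ≤ 2 ^ (-(t + s) / 3) ∧
      (k = 2 ^ (-(t + s) / 3) ∨ |b| ≤ k) ∧ (k = 2 ^ (-(t + s) / 2) ∨ k ≤ |b|))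
    (hab : |a - b| ≤ 2 ^ (-t / 6) * m + 2 ^ (-(t + s) / 6) * k) :
    k ≤ 8 * m ∧ m ≤ 8 * (k * 2 ^ (2 * s / 3)) := by
  have h2 : (0 : ℝ) < 2 := by norm_num
  have mono : ∀ {p q : ℝ}, p ≤ q → (2 : ℝ) ^ p ≤ 2 ^ q := fun h =>
    Real.rpow_le_rpow_of_exponent_le (by norm_num) h
  have hS : (1 : ℝ) ≤ 2 ^ (2 * s / 3) := Real.one_le_rpow (by norm_num) (by positivity)
  have e8 : (8 : ℝ) = 2 ^ (3 : ℝ) := by norm_num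
  have kS : k ≤ k * 2 ^ (2 * s / 3) := le_mul_of_one_le_right hk.le hS
  -- key tool
  have tool : ∀ q : ℝ, (2 : ℝ) ^ q ≤ k → 2 ^ (q + 2 * s / 3) ≤ k * 2 ^ (2 * s / 3) := by
    intro q hq
    rw [Real.rpow_add h2]
    gcongr
  rcases le_or_gt (t + s) 0 with hu | hu
  · have ht : t ≤ 0 := by linarith
    have hm := hm0 ht
    have hk' := hk0 hu
    constructor
    · have : k ≤ m := by rw [hm, hk']; exact mono (by linarith)
      linarith
    · have := tool _ hk'.ge
      have h3 : m ≤ 2 ^ (-(t + s) / 3 + 2 * s / 3) := by rw [hm]; exact mono (by linarith)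
      linarith
  obtain ⟨k1, k2, k3, k4⟩ := hk1 hu
  rcases le_or_gt t 0 with ht | ht
  · have hm := hm0 ht
    constructor
    · have : k ≤ m := by rw [hm]; exact k2.trans (mono (by linarith))
      linarith
    · have := tool _ k1
      have h3 : m ≤ 2 ^ (-(t + s) / 2 + 2 * s / 3) := by rw [hm]; exact mono (by linarith)
      linarith
  obtain ⟨m1, m2, m3, m4⟩ := hm1 ht
  have q1 : (2 : ℝ) ^ (-t / 6) ≤ 1 :=
    Real.rpow_le_one_of_one_le_of_nonpos (by norm_num) (by linarith)
  have q2 : (2 : ℝ) ^ (-(t + s) / 6) ≤ 1 :=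
    Real.rpow_le_one_of_one_le_of_nonpos (by norm_num) (by linarith)
  have r1 : (2 : ℝ) ^ (-t / 6) * m ≤ m := mul_le_of_le_one_left hm.le q1
  have r2 : (2 : ℝ) ^ (-(t + s) / 6) * k ≤ k := mul_le_of_le_one_left hk.le q2
  have half : (2 : ℝ) ^ (-1 : ℝ) = 1 / 2 := by rw [Real.rpow_neg_one]; norm_num
  have ab1 : |b| ≤ |a| + |a - b| := by
    have := abs_sub_abs_le_abs_sub b a
    rw [abs_sub_comm] at this
    linarith
  have ab2 : |a| ≤ |b| + |a - b| := by
    have := abs_sub_abs_le_abs_sub a b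
    linarith
  have k_le_one : k ≤ 1 :=
    k2.trans (Real.rpow_le_one_of_one_le_of_nonpos (by norm_num) (by linarith))
  have m_le_one : m ≤ 1 :=
    m2.trans (Real.rpow_le_one_of_one_le_of_nonpos (by norm_num) (by linarith))
  constructor
  · rcases m3 with m3 | m3
    · have : k ≤ m := by rw [m3]; exact k2.trans (mono (by linarith))
      linarith
    rcases k4 with k4 | k4
    · have : k ≤ m := by rw [k4]; exact (mono (by linarith)).trans m1
      linarith
    rcases le_or_gt 6 (t + s) with h6 | h6
    · have : (2 : ℝ) ^ (-(t + s) / 6) ≤ 1 / 2 := by rw [← half]; exact mono (by linarith)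
      have := mul_le_mul_of_nonneg_right this hk.le
      linarith
    · have h3 : (2 : ℝ) ^ (-3 : ℝ) ≤ m := (mono (by linarith)).trans m1
      have : (2 : ℝ) ^ (-3 : ℝ) = 1 / 8 := by rw [Real.rpow_neg h2.le, ← e8]; norm_num
      rw [this] at h3
      linarith
  · rcases m4 with m4 | m4
    · have := tool _ k1
      have h3 : m ≤ 2 ^ (-(t + s) / 2 + 2 * s / 3) := by rw [m4]; exact mono (by linarith)
      linarith
    rcases le_or_gt 6 t with h6 | h6
    · have : (2 : ℝ) ^ (-t / 6) ≤ 1 / 2 := by rw [← half]; exact mono (by linarith)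
      have := mul_le_mul_of_nonneg_right this hm.le
      rcases k3 with k3 | k3
      · have := tool _ k3.ge
        have h3 : m ≤ 2 ^ (-(t + s) / 3 + 2 * s / 3) := m2.trans (mono (by linarith))
        linarith
      · linarith
    · have := tool _ k1
      have h3 : (2 : ℝ) ^ (-3 : ℝ) ≤ 2 ^ (-(t + s) / 2 + 2 * s / 3) := mono (by linarith)
      have : (2 : ℝ) ^ (-3 : ℝ) = 1 / 8 := by rw [Real.rpow_neg h2.le, ← e8]; norm_num
      rw [this] at h3
      linarith

theorem sig_pos (a t : ℝ) : 0 < sig1 a t ∧ 0 < sig2 a t ∧ sig1 a t * sig2 a t = 2 ^ (-t) := by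
  obtain ⟨m, hm, h1, h2, -, -⟩ := exists_m a t
  rw [h1, h2]
  refine ⟨by positivity, by positivity, ?_⟩
  have : (2 : ℝ) ^ (-t) = 2 ^ (-(5 * t) / 6) * 2 ^ (-t / 6) := by
    rw [← Real.rpow_add (by norm_num)]; congr 1; ring
  rw [this]; field_simp

theorem ratio_bounds (a b t s : ℝ) (hs : 0 ≤ s)
    (hab : |a - b| ≤ sig2 a t + sig2 b (t + s)) :
    sig1 b (t + s) / sig1 a t ≤ 8 * 2 ^ (-(1 / 6 * s)) ∧
    sig2 b (t + s) / sig2 a t ≤ 8 * 2 ^ (-(1 / 6 * s)) ∧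
    sig1 a t / sig1 b (t + s) ≤ 8 * 2 ^ (5 / 6 * s) ∧
    sig2 a t / sig2 b (t + s) ≤ 8 * 2 ^ (5 / 6 * s) := by
  obtain ⟨m, hm, h1, h2, h3, h4⟩ := exists_m a t
  obtain ⟨k, hk, g1, g2, g3, g4⟩ := exists_m b (t + s)
  rw [h2, g2] at hab
  obtain ⟨A, B⟩ := m_bounds a b t s m k hs hm hk h3 h4 g3 g4 hab
  rw [h1, h2, g1, g2]
  have z : (0 : ℝ) < 2 := by norm_num
  have e1 : (2 : ℝ) ^ (-(5 * (t + s)) / 6) = 2 ^ (-(5 * t) / 6) * 2 ^ (-(5 / 6 * s)) := by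
    rw [← Real.rpow_add z]; congr 1; ring
  have e2 : (2 : ℝ) ^ (-(t + s) / 6) = 2 ^ (-t / 6) * 2 ^ (-(1 / 6 * s)) := by
    rw [← Real.rpow_add z]; congr 1; ring
  have e3 : (2 : ℝ) ^ (2 * s / 3) = 2 ^ (5 / 6 * s) * 2 ^ (-(1 / 6 * s)) := by
    rw [← Real.rpow_add z]; congr 1; ring
  have e4 : (2 : ℝ) ^ (-(5 / 6 * s)) * 2 ^ (5 / 6 * s) = 1 := by
    rw [← Real.rpow_add z]; simp
  rw [e1, e2]
  rw [e3] at B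
  have P : (0 : ℝ) < 2 ^ (-(5 * t) / 6) := by positivity
  have Q : (0 : ℝ) < 2 ^ (-t / 6) := by positivity
  have R : (0 : ℝ) < 2 ^ (-(5 / 6 * s)) := by positivity
  have S : (0 : ℝ) < 2 ^ (-(1 / 6 * s)) := by positivity
  have U : (0 : ℝ) < 2 ^ (5 / 6 * s) := by positivity
  generalize (2 : ℝ) ^ (-(5 * t) / 6) = p at *
  generalize (2 : ℝ) ^ (-t / 6) = q at *
  generalize (2 : ℝ) ^ (-(5 / 6 * s)) = r at *
  generalize (2 : ℝ) ^ (-(1 / 6 * s)) = w at *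
  generalize (2 : ℝ) ^ (5 / 6 * s) = v at *
  refine ⟨?_, ?_, ?_, ?_⟩
  · have : p * r / k / (p / m) = r * m / k := by field_simp
    rw [this, div_le_iff₀ hk]
    calc r * m ≤ r * (8 * (k * (v * w))) := by gcongr
      _ = (r * v) * (8 * w * k) := by ring
      _ = _ := by rw [e4]; ring
  · have : q * w * k / (q * m) = w * k / m := by field_simp
    rw [this, div_le_iff₀ hm]
    nlinarith
  · have : p / m / (p * r / k) = k / (m * r) := by field_simp
    rw [this, div_le_iff₀ (by positivity)]
    calc k ≤ 8 * m := A
      _ = 8 * m * (r * v) := by rw [e4]; ring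
      _ = _ := by ring
  · have : q * m / (q * w * k) = m / (w * k) := by field_simp
    rw [this, div_le_iff₀ (by positivity)]
    linarith

theorem opNorm_le (d : Fin 2 → ℝ) (c : ℝ) (h0 : |d 0| ≤ c) (h1 : |d 1| ≤ c) :
    opNorm (Matrix.diagonal d) ≤ c := by
  open scoped Matrix.Norms.L2Operator in
  have h : opNorm (Matrix.diagonal d) = ‖(Matrix.diagonal d : Matrix (Fin 2) (Fin 2) ℝ)‖ := rfl
  rw [h, Matrix.l2_opNorm_diagonal, pi_norm_le_iff_of_nonneg ((abs_nonneg _).trans h0)]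
  intro i
  fin_cases i
  · exact h0
  · exact h1

theorem le_opNorm (d : Fin 2 → ℝ) : d 0 ≤ opNorm (Matrix.diagonal d) := by
  open scoped Matrix.Norms.L2Operator in
  have h : opNorm (Matrix.diagonal d) = ‖(Matrix.diagonal d : Matrix (Fin 2) (Fin 2) ℝ)‖ := rfl
  rw [h, Matrix.l2_opNorm_diagonal]
  exact (le_abs_self _).trans (norm_le_pi_norm d 0)

theorem diag_inv_mul (a b c d : ℝ) (ha : 0 < a) (hb : 0 < b) :
    (Matrix.diagonal ![a, b])⁻¹ * Matrix.diagonal ![c, d] =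
      Matrix.diagonal ![c / a, d / b] := by
  have : (Matrix.diagonal ![a, b])⁻¹ = Matrix.diagonal ![a⁻¹, b⁻¹] := by
    apply Matrix.inv_eq_left_inv
    rw [Matrix.diagonal_mul_diagonal, ← Matrix.diagonal_one]
    congr 1
    ext i
    fin_cases i
    · simp [ha.ne']
    · simp [hb.ne']
  rw [this, Matrix.diagonal_mul_diagonal]
  congr 1
  ext i
  fin_cases i
  · simp; ring
  · simp; ring

theorem vol_ell (x : EuclideanSpace ℝ (Fin 2)) (t : ℝ) :
    volR (ell (M0 x t) x) =
      (volume (Metric.closedBall (0 : EuclideanSpace ℝ (Fin 2)) 1)).toReal * 2 ^ (-t) := by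
  obtain ⟨p1, p2, p3⟩ := sig_pos (x 1) t
  have h : ell (M0 x t) x = (fun z => z + x) ''
      (Matrix.toEuclideanLin (M0 x t) '' Metric.closedBall 0 1) := by
    rw [Set.image_image]; rfl
  have hd : LinearMap.det (Matrix.toEuclideanLin (M0 x t)) = 2 ^ (-t) := by
    rw [Matrix.toEuclideanLin_eq_toLin_orthonormal, LinearMap.det_toLin]
    simp [M0, p3]
  unfold volR
  rw [h, Set.image_add_right, measure_preimage_add_right, Measure.addHaar_image_linearMap, hd,
    ENNReal.toReal_mul, ENNReal.toReal_ofReal (abs_nonneg _), abs_of_pos (by positivity), mul_comm]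

theorem ell_coord (x z : EuclideanSpace ℝ (Fin 2)) (t : ℝ) (hz : z ∈ ell (M0 x t) x) :
    |z 1 - x 1| ≤ sig2 (x 1) t := by
  obtain ⟨w, hw, rfl⟩ := hz
  have p2 := (sig_pos (x 1) t).2.1
  have hw1 : |w 1| ≤ 1 := by
    have := PiLp.norm_apply_le w 1
    rw [mem_closedBall_zero_iff] at hw
    exact this.trans hw
  have : (Matrix.toEuclideanLin (M0 x t) w + x) 1 - x 1 = sig2 (x 1) t * w 1 := by
    simp [M0, Matrix.toLpLin_apply, Matrix.mulVec_diagonal]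
  rw [this, abs_mul, abs_of_pos p2]
  exact mul_le_of_le_one_right p2.le hw1

/-- `Θ₀ = {θ_{x,t} = M_{x,t}(𝔹²) + x}` is a continuous ellipsoid cover of `ℝ²`. -/
theorem stmt18 :
    ∃ a₁ a₂ a₃ a₄ a₅ a₆ : ℝ,
      0 < a₁ ∧ 0 < a₂ ∧ 0 < a₃ ∧ 0 < a₄ ∧ 0 < a₅ ∧ 0 < a₆ ∧
      (∀ (x : EuclideanSpace ℝ (Fin 2)) (t : ℝ),
        a₁ * 2 ^ (-t) ≤ volR (ell (M0 x t) x) ∧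
        volR (ell (M0 x t) x) ≤ a₂ * 2 ^ (-t)) ∧
      (∀ (x y : EuclideanSpace ℝ (Fin 2)) (t s : ℝ), 0 ≤ s →
        (ell (M0 x t) x ∩ ell (M0 y (t + s)) y).Nonempty →
        a₃ * 2 ^ (-(a₄ * s)) ≤ 1 / opNorm ((M0 y (t + s))⁻¹ * M0 x t) ∧
        1 / opNorm ((M0 y (t + s))⁻¹ * M0 x t) ≤ opNorm ((M0 x t)⁻¹ * M0 y (t + s)) ∧
        opNorm ((M0 x t)⁻¹ * M0 y (t + s)) ≤ a₅ * 2 ^ (-(a₆ * s))) := by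
  have hv : 0 < (volume (Metric.closedBall (0 : EuclideanSpace ℝ (Fin 2)) 1)).toReal :=
    ENNReal.toReal_pos (Metric.measure_closedBall_pos _ _ one_pos).ne'
      measure_closedBall_lt_top.ne
  refine ⟨_, _, 1 / 8, 5 / 6, 8, 1 / 6, hv, hv, by norm_num, by norm_num, by norm_num,
    by norm_num, fun x t => ⟨(vol_ell x t).ge, (vol_ell x t).le⟩, ?_⟩
  rintro x y t s hs ⟨z, hzx, hzy⟩
  have hab : |x 1 - y 1| ≤ sig2 (x 1) t + sig2 (y 1) (t + s) := by
    have h1 := ell_coord x z t hzx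
    have h2 := ell_coord y z (t + s) hzy
    rw [abs_sub_comm] at h1
    exact (abs_sub_le (x 1) (z 1) (y 1)).trans (add_le_add h1 h2)
  obtain ⟨r1, r2, r3, r4⟩ := ratio_bounds (x 1) (y 1) t s hs hab
  obtain ⟨p1, p2, -⟩ := sig_pos (x 1) t
  obtain ⟨q1, q2, -⟩ := sig_pos (y 1) (t + s)
  unfold M0
  rw [diag_inv_mul _ _ _ _ p1 p2, diag_inv_mul _ _ _ _ q1 q2]
  have hpos : 0 < sig1 (x 1) t / sig1 (y 1) (t + s) := by positivity
  have hN : sig1 (x 1) t / sig1 (y 1) (t + s) ≤ opNorm (Matrix.diagonal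
    ![sig1 (x 1) t / sig1 (y 1) (t + s), sig2 (x 1) t / sig2 (y 1) (t + s)]) :=
    le_opNorm ![sig1 (x 1) t / sig1 (y 1) (t + s), sig2 (x 1) t / sig2 (y 1) (t + s)]
  refine ⟨?_, ?_, ?_⟩
  · have : (1 : ℝ) / 8 * 2 ^ (-(5 / 6 * s)) = 1 / (8 * 2 ^ (5 / 6 * s)) := by
      rw [Real.rpow_neg (by norm_num)]; field_simp
    rw [this]
    refine one_div_le_one_div_of_le (hpos.trans_le hN) (opNorm_le _ _ ?_ ?_)
    · simpa [abs_of_pos, p1, q1] using r3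
    · simpa [abs_of_pos, p2, q2] using r4
  · refine (one_div_le_one_div_of_le hpos hN).trans ?_
    rw [one_div_div]
    exact le_opNorm ![sig1 (y 1) (t + s) / sig1 (x 1) t, sig2 (y 1) (t + s) / sig2 (x 1) t]
  · refine opNorm_le _ _ ?_ ?_
    · simpa [abs_of_pos, p1, q1] using r1
    · simpa [abs_of_pos, p2, q2] using r2
end
end
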